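/- For every sequence (a(d))_{d≥1} of rational numbers with a(d) ≥ 1 for all d, there exist constants C, D > 0 such that for every d ≥ 1, the Gaussian measure γ_{N_d} of the set of coefficient vectors (a_j)_{j∈J_d} ∈ ℝ^{N_d} for which the zero set {(x,y) ∈ ℝ² : P_a(x,y) = 0} of the polynomial P_a(x,y) = Σ_{(j_1,j_2)∈J_d} a_{(j_1,j_2)} √((d+2)!/(2!·j_1!·j_2!·(d−j_1−j_2)!)) x^{j_1} y^{j_2} has at least d²/2 − d·a(d) connected components is at most C · d^6 · exp(−D·d/a(d)). -/

import Mathlib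

open MeasureTheory

/-- The standard Gaussian probability measure on `ℝ^ι` for a finite index type `ι`, with
density `a ↦ e^{−|a|²}/π^{card ι / 2}` with respect to Lebesgue measure. -/
noncomputable def gaussianMeasure (ι : Type*) [Fintype ι] : Measure (ι → ℝ) :=
  volume.withDensity fun a =>
    ENNReal.ofReal (Real.exp (-(∑ i, a i ^ 2)) / Real.pi ^ ((Fintype.card ι : ℝ) / 2))

/-- The index set `J_d = {(j₁, j₂) ∈ ℕ² : j₁ + j₂ ≤ d}`, realized as a finite type. -/
def degIndex (d : ℕ) : Type :=
  {p : Fin (d + 1) × Fin (d + 1) // (p.1 : ℕ) + (p.2 : ℕ) ≤ d}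

instance (d : ℕ) : Fintype (degIndex d) := by unfold degIndex; infer_instance

/-- The Kostlan polynomial in two variables
`P_a(x,y) = Σ_{j₁+j₂≤d} a_{(j₁,j₂)} √((d+2)!/(2!·j₁!·j₂!·(d−j₁−j₂)!)) x^{j₁} y^{j₂}`
associated to a coefficient vector `a ∈ ℝ^{N_d}`. -/
noncomputable def kostlanPoly₂ (d : ℕ) (a : degIndex d → ℝ) (x y : ℝ) : ℝ :=
  ∑ p : degIndex d,
    a p * Real.sqrt ((d + 2).factorial /
        (Nat.factorial 2 * ((p.1.1 : ℕ).factorial * ((p.1.2 : ℕ).factorial *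
          (d - (p.1.1 : ℕ) - (p.1.2 : ℕ)).factorial)))) *
      x ^ (p.1.1 : ℕ) * y ^ (p.1.2 : ℕ)

/-- The integral of `exp (-c |a|²)` over `ℝ^ι`. -/
theorem lintegral_exp_neg_mul_sum_sq {ι : Type*} [Fintype ι] {c : ℝ} (hc : 0 < c) :
    ∫⁻ a : ι → ℝ, ENNReal.ofReal (Real.exp (-c * ∑ i, a i ^ 2)) =
      ENNReal.ofReal ((Real.pi / c) ^ ((Fintype.card ι : ℝ) / 2)) := by
  have hprod : ∀ a : ι → ℝ, Real.exp (-c * ∑ i, a i ^ 2) = ∏ i, Real.exp (-c * a i ^ 2) := by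
    intro a
    rw [← Real.exp_sum, Finset.mul_sum]
  have hintegrable : Integrable (fun a : ι → ℝ => Real.exp (-c * ∑ i, a i ^ 2)) := by
    simp_rw [hprod]
    exact Integrable.fintype_prod (f := fun _ (x : ℝ) => Real.exp (-c * x ^ 2))
      (fun i => integrable_exp_neg_mul_sq hc)
  rw [← ofReal_integral_eq_lintegral_ofReal hintegrable (Filter.Eventually.of_forall
    fun a => (Real.exp_pos _).le)]
  congr 1
  simp_rw [hprod]
  rw [integral_fintype_prod_volume_eq_pow (fun x : ℝ => Real.exp (-c * x ^ 2)), integral_gaussian,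
    Real.sqrt_eq_rpow, ← Real.rpow_natCast, ← Real.rpow_mul (by positivity)]
  congr 1
  ring

theorem measurable_gaussianDensity (ι : Type*) [Fintype ι] :
    Measurable fun a : ι → ℝ =>
      ENNReal.ofReal (Real.exp (-(∑ i, a i ^ 2)) / Real.pi ^ ((Fintype.card ι : ℝ) / 2)) := by
  fun_prop

theorem gaussianMeasure_apply_univ (ι : Type*) [Fintype ι] :
    gaussianMeasure ι Set.univ = 1 := by
  have hpi : (0 : ℝ) < Real.pi ^ ((Fintype.card ι : ℝ) / 2) := Real.rpow_pos_of_pos Real.pi_pos _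
  have h := lintegral_exp_neg_mul_sum_sq (ι := ι) one_pos
  simp only [neg_mul, one_mul, div_one] at h
  rw [gaussianMeasure, withDensity_apply _ MeasurableSet.univ, Measure.restrict_univ]
  simp_rw [ENNReal.ofReal_div_of_pos hpi, div_eq_mul_inv]
  rw [lintegral_mul_const _ (by fun_prop), h]
  exact ENNReal.mul_inv_cancel (by simpa using hpi) ENNReal.ofReal_ne_top

/-- Gaussian tail estimate obtained from the exponential Markov inequality. -/
theorem gaussianMeasure_norm_tail_le (ι : Type*) [Fintype ι] (R : ℝ) :
    gaussianMeasure ι {a | R ^ 2 < ∑ i, a i ^ 2} ≤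
      ENNReal.ofReal (2 ^ ((Fintype.card ι : ℝ) / 2) * Real.exp (-R ^ 2 / 2)) := by
  have hpi : (0 : ℝ) < Real.pi ^ ((Fintype.card ι : ℝ) / 2) := Real.rpow_pos_of_pos Real.pi_pos _
  have hmeas : MeasurableSet {a : ι → ℝ | R ^ 2 < ∑ i, a i ^ 2} :=
    measurableSet_lt (by fun_prop) (by fun_prop)
  rw [gaussianMeasure, withDensity_apply _ hmeas]
  calc _ ≤ ∫⁻ a in {a : ι → ℝ | R ^ 2 < ∑ i, a i ^ 2},
        ENNReal.ofReal (Real.exp (-R ^ 2 / 2) / Real.pi ^ ((Fintype.card ι : ℝ) / 2)) *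
          ENNReal.ofReal (Real.exp (-(1 / 2) * ∑ i, a i ^ 2)) := by
        refine setLIntegral_mono (by fun_prop) fun a ha => ?_
        rw [← ENNReal.ofReal_mul (by positivity)]
        refine ENNReal.ofReal_le_ofReal ?_
        rw [div_mul_eq_mul_div, ← Real.exp_add]
        gcongr
        have : R ^ 2 < ∑ i, a i ^ 2 := ha
        linarith
    _ ≤ ∫⁻ a : ι → ℝ, 
        ENNReal.ofReal (Real.exp (-R ^ 2 / 2) / Real.pi ^ ((Fintype.card ι : ℝ) / 2)) *
          ENNReal.ofReal (Real.exp (-(1 / 2) * ∑ i, a i ^ 2)) := setLIntegral_le_lintegral _ _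
    _ = _ := by
        rw [lintegral_const_mul _ (by fun_prop), lintegral_exp_neg_mul_sum_sq (by norm_num),
          ← ENNReal.ofReal_mul (by positivity)]
        congr 1
        rw [show Real.pi / (1 / 2) = 2 * Real.pi by ring, Real.mul_rpow (by norm_num) Real.pi_pos.le]
        field_simp

/-- Translating a subset of a ball by a vector of length at most `1 / R` changes its Gaussian
measure by at most a bounded factor. -/
theorem gaussianMeasure_le_translate {ι : Type*} [Fintype ι] {R : ℝ} (hR : 1 ≤ R)
    {S : Set (ι → ℝ)} (hS : MeasurableSet S) (hSR : ∀ a ∈ S, ∑ i, a i ^ 2 ≤ R ^ 2)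
    (h : ι → ℝ) (hh : ∑ i, h i ^ 2 ≤ (1 / R) ^ 2) :
    gaussianMeasure ι S ≤ ENNReal.ofReal (Real.exp 3) * gaussianMeasure ι {b | b - h ∈ S} := by
  have hpi : (0 : ℝ) < Real.pi ^ ((Fintype.card ι : ℝ) / 2) := Real.rpow_pos_of_pos Real.pi_pos _
  have hT : MeasurableSet {b : ι → ℝ | b - h ∈ S} := (measurable_id.sub_const h) hS
  rw [gaussianMeasure, withDensity_apply _ hS, withDensity_apply _ hT,
    ← lintegral_indicator hS, ← lintegral_indicator hT,
    ← lintegral_const_mul _ ((measurable_gaussianDensity ι).indicator hT)]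
  conv_rhs => rw [← lintegral_add_right_eq_self _ h]
  refine lintegral_mono fun a => ?_
  by_cases ha : a ∈ S
  · have ha' : a + h ∈ {b : ι → ℝ | b - h ∈ S} := by simpa using ha
    rw [Set.indicator_of_mem ha, Set.indicator_of_mem ha', ← ENNReal.ofReal_mul (by positivity)]
    refine ENNReal.ofReal_le_ofReal ?_
    rw [← mul_div_assoc, ← Real.exp_add]
    gcongr
    have hcs : ∑ i, a i * h i ≤ 1 := by
      have h1 : (∑ i, a i * h i) ^ 2 ≤ (∑ i, a i ^ 2) * ∑ i, h i ^ 2 :=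
        Finset.sum_mul_sq_le_sq_mul_sq _ _ _
      have h2 : (∑ i, a i ^ 2) * ∑ i, h i ^ 2 ≤ R ^ 2 * (1 / R) ^ 2 :=
        mul_le_mul (hSR a ha) hh (Finset.sum_nonneg fun i _ => sq_nonneg _) (by positivity)
      have h3 : R ^ 2 * (1 / R) ^ 2 = 1 := by
        rw [← mul_pow, mul_one_div_cancel (by positivity), one_pow]
      nlinarith
    have hh1 : ∑ i, h i ^ 2 ≤ 1 := by
      refine hh.trans (pow_le_one₀ (by positivity) ?_)
      rw [div_le_one (by positivity)]
      exact hR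
    have hexp : ∑ i, (a + h) i ^ 2 = ∑ i, a i ^ 2 + 2 * ∑ i, a i * h i + ∑ i, h i ^ 2 := by
      rw [Finset.mul_sum, ← Finset.sum_add_distrib, ← Finset.sum_add_distrib]
      exact Finset.sum_congr rfl fun i _ => by simp only [Pi.add_apply]; ring
    rw [hexp]
    linarith
  · rw [Set.indicator_of_notMem ha]
    exact zero_le

instance isProbabilityMeasure_gaussianMeasure (ι : Type*) [Fintype ι] :
    IsProbabilityMeasure (gaussianMeasure ι) := ⟨gaussianMeasure_apply_univ ι⟩

theorem volume_setOf_abs_sub_mulVec_le (A : Matrix (Fin 3) (Fin 3) ℝ) (c : Fin 3 → ℝ) {ε μ : ℝ}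
    (hε : 0 ≤ ε) (hμ : 0 < μ) (hA : μ ≤ |A.det|) :
    volume {t : Fin 3 → ℝ | ∀ i, |c i - A.mulVec t i| ≤ ε} ≤ ENNReal.ofReal ((2 * ε) ^ 3 / μ) := by
  have hdet : LinearMap.det (Matrix.toLin' A) ≠ 0 := by
    rw [LinearMap.det_toLin']
    intro h
    rw [h, abs_zero] at hA
    linarith
  have hset : {t : Fin 3 → ℝ | ∀ i, |c i - A.mulVec t i| ≤ ε} =
      Matrix.toLin' A ⁻¹' Set.Icc (fun i => c i - ε) (fun i => c i + ε) := by
    ext t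
    simp only [Set.mem_ofPred_eq, Set.mem_preimage, Set.mem_Icc, Pi.le_def, Matrix.toLin'_apply,
      abs_le, ← forall_and]
    refine forall_congr' fun i => ?_
    constructor <;> rintro ⟨h1, h2⟩ <;> constructor <;> linarith
  rw [hset, Measure.addHaar_preimage_linearMap _ hdet, Real.volume_Icc_pi, LinearMap.det_toLin']
  simp only [Fin.prod_univ_three]
  rw [← ENNReal.ofReal_mul (by linarith), ← ENNReal.ofReal_mul (by nlinarith),
    ← ENNReal.ofReal_mul (by positivity)]
  refine ENNReal.ofReal_le_ofReal ?_
  have e1 : ∀ x : ℝ, x + ε - (x - ε) = 2 * ε := fun x => by ring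
  rw [e1, e1, e1, abs_inv, div_eq_inv_mul]
  rw [show 2 * ε * (2 * ε) * (2 * ε) = (2 * ε) ^ 3 by ring]
  gcongr

/-- Three linear functionals that are quantitatively independent are simultaneously small only
with cubically small Gaussian probability. -/
theorem gaussianMeasure_three_small_le {ι : Type*} [Fintype ι] (l : Fin 3 → (ι → ℝ) →ₗ[ℝ] ℝ)
    (w : Fin 3 → ι → ℝ) (hw : ∀ j, ∑ i, w j i ^ 2 ≤ 1) {R ε μ : ℝ} (hR : 1 ≤ R) (hε : 0 ≤ ε)
    (hμ : 0 < μ) (hdet : μ ≤ |(Matrix.of fun i j => l i (w j)).det|) :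
    gaussianMeasure ι {a | ∑ i, a i ^ 2 ≤ R ^ 2 ∧ ∀ i, |l i a| ≤ ε} ≤
      ENNReal.ofReal (Real.exp 3 * (3 * R) ^ 3 * ((2 * ε) ^ 3 / μ)) := by
  set S : Set (ι → ℝ) := {a | ∑ i, a i ^ 2 ≤ R ^ 2 ∧ ∀ i, |l i a| ≤ ε} with hSdef
  have hlc : ∀ i, Continuous (l i) := fun i => LinearMap.continuous_of_finiteDimensional _
  have hSc : IsClosed S := by
    have : S = {a | ∑ i, a i ^ 2 ≤ R ^ 2} ∩ ⋂ i, {a | |l i a| ≤ ε} := by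
      ext a; simp [hSdef]
    rw [this]
    refine (isClosed_le (by fun_prop) (by fun_prop)).inter
      (isClosed_iInter fun i => isClosed_le (by have := hlc i; fun_prop) (by fun_prop))
  have hS : MeasurableSet S := hSc.measurableSet
  have hRpos : 0 < R := by linarith
  set W : (Fin 3 → ℝ) → ι → ℝ := fun t i => ∑ j, t j * w j i with hW
  have hWc : Continuous W := by
    refine continuous_pi fun i => ?_
    simp only [hW]
    fun_prop
  set τ : ℝ := 1 / (3 * R) with hτ
  have hτpos : 0 < τ := by positivity
  set T : Set (Fin 3 → ℝ) := Set.Icc (fun _ => 0) (fun _ => τ) with hT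
  have hTm : MeasurableSet T := measurableSet_Icc
  have hvolT : volume T = ENNReal.ofReal (τ ^ 3) := by
    rw [hT, Real.volume_Icc_pi]
    simp only [Fin.prod_univ_three, sub_zero]
    rw [← ENNReal.ofReal_mul hτpos.le, ← ENNReal.ofReal_mul (by positivity)]
    congr 1
    ring
  have hWT : ∀ t ∈ T, ∑ i, W t i ^ 2 ≤ (1 / R) ^ 2 := by
    intro t ht
    have ht2 : ∑ j, t j ^ 2 ≤ 3 * τ ^ 2 := by
      have : ∀ j ∈ Finset.univ, t j ^ 2 ≤ τ ^ 2 := fun j _ =>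
        pow_le_pow_left₀ (ht.1 j) (ht.2 j) 2
      simpa using Finset.sum_le_card_nsmul _ _ _ this
    calc ∑ i, W t i ^ 2 ≤ ∑ i, (∑ j, t j ^ 2) * ∑ j, w j i ^ 2 :=
          Finset.sum_le_sum fun i _ => Finset.sum_mul_sq_le_sq_mul_sq _ _ _
      _ = (∑ j, t j ^ 2) * ∑ j, ∑ i, w j i ^ 2 := by
          rw [← Finset.mul_sum, Finset.sum_comm]
      _ ≤ (3 * τ ^ 2) * 3 := by
          refine mul_le_mul ht2 ?_ (by positivity) (by positivity)
          have := Finset.sum_le_card_nsmul Finset.univ (fun j => ∑ i, w j i ^ 2) 1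
            (fun j _ => hw j)
          simpa using this
      _ = (1 / R) ^ 2 := by
          rw [hτ]
          field_simp
  set G : Set ((Fin 3 → ℝ) × (ι → ℝ)) := {p | p.1 ∈ T ∧ p.2 - W p.1 ∈ S} with hG
  have hGm : MeasurableSet G := by
    have h1 : Measurable fun p : (Fin 3 → ℝ) × (ι → ℝ) => p.2 - W p.1 := by
      exact (continuous_snd.sub (hWc.comp continuous_fst)).measurable
    exact (measurable_fst hTm).inter (h1 hS)
  have hlow : volume T * gaussianMeasure ι S ≤
      ENNReal.ofReal (Real.exp 3) * (volume.prod (gaussianMeasure ι)) G := by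
    rw [Measure.prod_apply hGm, ← lintegral_const_mul _ (measurable_measure_prodMk_left hGm),
      mul_comm, ← setLIntegral_const]
    rw [← lintegral_indicator hTm]
    refine lintegral_mono fun t => ?_
    by_cases ht : t ∈ T
    · rw [Set.indicator_of_mem ht]
      refine (gaussianMeasure_le_translate hR hS (fun a ha => ha.1) (W t) (hWT t ht)).trans ?_
      gcongr
      intro b hb
      exact ⟨ht, hb⟩
    · rw [Set.indicator_of_notMem ht]
      exact zero_le
  have hup : (volume.prod (gaussianMeasure ι)) G ≤ ENNReal.ofReal ((2 * ε) ^ 3 / μ) := by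
    rw [Measure.prod_apply_symm hGm]
    calc _ ≤ ∫⁻ _ : ι → ℝ, ENNReal.ofReal ((2 * ε) ^ 3 / μ) ∂(gaussianMeasure ι) := by
          refine lintegral_mono fun b => ?_
          refine le_trans (measure_mono ?_)
            (volume_setOf_abs_sub_mulVec_le (Matrix.of fun i j => l i (w j)) (fun i => l i b)
              hε hμ hdet)
          intro t ht i
          have h := ht.2.2 i
          have hWsum : W t = ∑ j, t j • w j := by
            ext i
            simp [hW]
          have : l i (b - W t) = l i b - (Matrix.of fun i j => l i (w j)).mulVec t i := by
            rw [hWsum, map_sub, map_sum]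
            simp [Matrix.mulVec, dotProduct, mul_comm]
          rw [← this]
          exact h
      _ = _ := by rw [lintegral_const, measure_univ, mul_one]
  have hmain : ENNReal.ofReal (τ ^ 3) * gaussianMeasure ι S ≤
      ENNReal.ofReal (Real.exp 3 * ((2 * ε) ^ 3 / μ)) := by
    rw [← hvolT, ENNReal.ofReal_mul (by positivity)]
    exact hlow.trans (by gcongr)
  have hτ3 : ENNReal.ofReal (τ ^ 3) ≠ 0 := by simpa using by positivity
  rw [mul_comm, ← ENNReal.le_div_iff_mul_le (Or.inl hτ3) (Or.inl ENNReal.ofReal_ne_top),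
    ← ENNReal.ofReal_div_of_pos (by positivity)] at hmain
  refine hmain.trans (ENNReal.ofReal_le_ofReal (le_of_eq ?_))
  rw [hτ]
  field_simp

/-- The square of the Kostlan weight of a monomial. -/
noncomputable def kostlanWeight (d : ℕ) (p : degIndex d) : ℝ :=
  (d + 2).factorial /
    (Nat.factorial 2 * ((p.1.1 : ℕ).factorial * ((p.1.2 : ℕ).factorial *
      (d - (p.1.1 : ℕ) - (p.1.2 : ℕ)).factorial)))

theorem kostlanWeight_nonneg (d : ℕ) (p : degIndex d) : 0 ≤ kostlanWeight d p := by
  unfold kostlanWeight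
  positivity

/-- The homogeneous Kostlan form in three variables, evaluated in an `ℝ`-algebra. -/
noncomputable def kostlanForm {K : Type*} [CommRing K] [Algebra ℝ K] (d : ℕ) (a : degIndex d → ℝ)
    (X : Fin 3 → K) : K :=
  ∑ p : degIndex d, algebraMap ℝ K (a p * Real.sqrt (kostlanWeight d p)) *
    (X 0 ^ (p.1.1 : ℕ) * X 1 ^ (p.1.2 : ℕ) * X 2 ^ (d - (p.1.1 : ℕ) - (p.1.2 : ℕ)))

theorem kostlanPoly₂_eq_kostlanForm (d : ℕ) (a : degIndex d → ℝ) (x y : ℝ) :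
    kostlanPoly₂ d a x y = kostlanForm d a ![x, y, 1] := by
  unfold kostlanPoly₂ kostlanForm kostlanWeight
  refine Finset.sum_congr rfl fun p _ => ?_
  simp [mul_assoc]

theorem kostlanForm_map {K L : Type*} [CommRing K] [Algebra ℝ K] [CommRing L] [Algebra ℝ L]
    (φ : K →ₐ[ℝ] L) (d : ℕ) (a : degIndex d → ℝ) (X : Fin 3 → K) :
    φ (kostlanForm d a X) = kostlanForm d a (fun i => φ (X i)) := by
  simp [kostlanForm, map_sum]

theorem kostlanForm_smul {d : ℕ} (a : degIndex d → ℝ) (t : ℝ) (X : Fin 3 → ℝ) :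
    kostlanForm d a (fun i => t * X i) = t ^ d * kostlanForm d a X := by
  unfold kostlanForm
  rw [Finset.mul_sum]
  refine Finset.sum_congr rfl fun p _ => ?_
  have h : t ^ d = t ^ (p.1.1 : ℕ) * t ^ (p.1.2 : ℕ) * t ^ (d - (p.1.1 : ℕ) - (p.1.2 : ℕ)) := by
    rw [← pow_add, ← pow_add]
    congr 1
    have := p.2
    omega
  rw [h]
  ring

theorem sum_degIndex {M : Type*} [AddCommMonoid M] (d : ℕ) (f : ℕ → ℕ → M) :
    ∑ p : degIndex d, f p.1.1 p.1.2 =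
      ∑ j ∈ Finset.range (d + 1), ∑ k ∈ Finset.range (d - j + 1), f j k := by
  rw [Finset.sum_sigma']
  refine Finset.sum_bij (fun p _ => ⟨(p.1.1 : ℕ), (p.1.2 : ℕ)⟩) ?_ ?_ ?_ ?_
  · intro p _
    have := p.2
    simp only [Finset.mem_sigma, Finset.mem_range]
    omega
  · rintro ⟨⟨p1, p2⟩, hp⟩ _ ⟨⟨q1, q2⟩, hq⟩ _ h
    simp only [Sigma.mk.injEq, heq_eq_eq, Fin.val_inj] at h
    obtain ⟨rfl, rfl⟩ := h
    rfl
  · rintro ⟨j, k⟩ h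
    simp only [Finset.mem_sigma, Finset.mem_range] at h
    exact ⟨⟨(⟨j, by omega⟩, ⟨k, by omega⟩), by simp only; omega⟩, Finset.mem_univ _, rfl⟩
  · intro p _
    rfl

/-- Trinomial expansion in terms of the Kostlan weights. -/
theorem sum_kostlanWeight_mul (d : ℕ) (x y z : ℝ) :
    ∑ p : degIndex d, kostlanWeight d p *
      (x ^ (p.1.1 : ℕ) * y ^ (p.1.2 : ℕ) * z ^ (d - (p.1.1 : ℕ) - (p.1.2 : ℕ))) =
      ((d + 1) * (d + 2) / 2) * (x + y + z) ^ d := by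
  unfold kostlanWeight
  rw [sum_degIndex d (fun j k => (((d + 2).factorial : ℝ) /
    (Nat.factorial 2 * (j.factorial * (k.factorial * (d - j - k).factorial)))) *
      (x ^ j * y ^ k * z ^ (d - j - k))), add_assoc, add_pow, Finset.mul_sum]
  refine Finset.sum_congr rfl fun j hj => ?_
  rw [add_pow, Finset.mul_sum, Finset.sum_mul, Finset.mul_sum]
  refine Finset.sum_congr rfl fun k hk => ?_
  rw [Finset.mem_range] at hj hk
  rw [Nat.cast_choose ℝ (by omega : j ≤ d), Nat.cast_choose ℝ (by omega : k ≤ d - j)]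
  have h1 : ((d + 2).factorial : ℝ) = (d + 2) * ((d + 1) * d.factorial) := by
    rw [Nat.factorial_succ, Nat.factorial_succ]
    push_cast
    ring
  have e1 := Nat.factorial_ne_zero j
  have e2 := Nat.factorial_ne_zero k
  have e3 := Nat.factorial_ne_zero (d - j)
  have e4 := Nat.factorial_ne_zero (d - j - k)
  rw [h1, Nat.factorial_two]
  push_cast
  field_simp

theorem norm_kostlanForm_sq_le (d : ℕ) (a : degIndex d → ℝ) (X : Fin 3 → ℂ) :
    ‖kostlanForm d a X‖ ^ 2 ≤ (∑ p, a p ^ 2) *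
      (((d + 1) * (d + 2) / 2) * (‖X 0‖ ^ 2 + ‖X 1‖ ^ 2 + ‖X 2‖ ^ 2) ^ d) := by
  rw [← sum_kostlanWeight_mul]
  have h1 : ‖kostlanForm d a X‖ ≤ ∑ p : degIndex d, |a p| * (Real.sqrt (kostlanWeight d p) *
      (‖X 0‖ ^ (p.1.1 : ℕ) * ‖X 1‖ ^ (p.1.2 : ℕ) *
        ‖X 2‖ ^ (d - (p.1.1 : ℕ) - (p.1.2 : ℕ)))) := by
    refine (norm_sum_le _ _).trans (le_of_eq (Finset.sum_congr rfl fun p _ => ?_))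
    rw [norm_mul, norm_mul, norm_mul, norm_pow, norm_pow, norm_pow, norm_algebraMap', 
      Real.norm_eq_abs, abs_mul, abs_of_nonneg (Real.sqrt_nonneg _), mul_assoc]
  refine (pow_le_pow_left₀ (norm_nonneg _) h1 2).trans
    ((Finset.sum_mul_sq_le_sq_mul_sq _ _ _).trans (le_of_eq ?_))
  congr 1
  · simp
  · refine Finset.sum_congr rfl fun p _ => ?_
    rw [mul_pow, Real.sq_sqrt (kostlanWeight_nonneg d p)]
    ring

/-- The coefficient vector representing evaluation at `Y`. -/
noncomputable def kostlanKernel (d : ℕ) (Y : Fin 3 → ℝ) : degIndex d → ℝ := fun p =>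
  Real.sqrt (kostlanWeight d p) *
    (Y 0 ^ (p.1.1 : ℕ) * Y 1 ^ (p.1.2 : ℕ) * Y 2 ^ (d - (p.1.1 : ℕ) - (p.1.2 : ℕ)))

theorem kostlanForm_kostlanKernel (d : ℕ) (X Y : Fin 3 → ℝ) :
    kostlanForm d (kostlanKernel d Y) X =
      ((d + 1) * (d + 2) / 2) * (∑ i, X i * Y i) ^ d := by
  rw [Fin.sum_univ_three, ← sum_kostlanWeight_mul]
  refine Finset.sum_congr rfl fun p _ => ?_
  have h := Real.mul_self_sqrt (kostlanWeight_nonneg d p)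
  simp only [kostlanKernel, Algebra.algebraMap_self, RingHom.id_apply, mul_pow]
  linear_combination (X 0 ^ (p.1.1 : ℕ) * X 1 ^ (p.1.2 : ℕ) *
    X 2 ^ (d - (p.1.1 : ℕ) - (p.1.2 : ℕ))) * (Y 0 ^ (p.1.1 : ℕ) * Y 1 ^ (p.1.2 : ℕ) *
    Y 2 ^ (d - (p.1.1 : ℕ) - (p.1.2 : ℕ))) * h

theorem sum_kostlanKernel_sq (d : ℕ) (Y : Fin 3 → ℝ) :
    ∑ p, kostlanKernel d Y p ^ 2 = ((d + 1) * (d + 2) / 2) * (∑ i, Y i ^ 2) ^ d := by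
  rw [Fin.sum_univ_three, ← sum_kostlanWeight_mul]
  refine Finset.sum_congr rfl fun p _ => ?_
  rw [kostlanKernel, mul_pow, Real.sq_sqrt (kostlanWeight_nonneg d p)]
  ring

theorem card_degIndex_le (d : ℕ) : Fintype.card (degIndex d) ≤ (d + 1) ^ 2 := by
  refine (Fintype.card_subtype_le _).trans ?_
  simp [sq]

/-- Evaluation at `p` of the bivariate polynomial with coefficients `b j k`, `j, k < n`. -/
noncomputable def biEval (b : ℕ → ℕ → ℝ) (n : ℕ) (p : ℝ × ℝ) : ℝ :=
  ∑ j ∈ Finset.range n, ∑ k ∈ Finset.range n, b j k * p.1 ^ j * p.2 ^ k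

/-- All coefficients with an index at least `n` vanish. -/
def BiSupp (b : ℕ → ℕ → ℝ) (n : ℕ) : Prop := ∀ j k, n ≤ j ∨ n ≤ k → b j k = 0

/-- Geometric decay of the coefficients, with ratio `1 / r`. -/
def BiBound (b : ℕ → ℕ → ℝ) (M r : ℝ) : Prop := ∀ j k, |b j k| ≤ M / r ^ (j + k)

/-- Coefficients of the derivative in the first variable. -/
def biD₁ (b : ℕ → ℕ → ℝ) : ℕ → ℕ → ℝ := fun j k => (j + 1) * b (j + 1) k

/-- Coefficients of the derivative in the second variable. -/
def biD₂ (b : ℕ → ℕ → ℝ) : ℕ → ℕ → ℝ := fun j k => (k + 1) * b j (k + 1)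

theorem BiSupp.biD₁ {b : ℕ → ℕ → ℝ} {n : ℕ} (h : BiSupp b n) : BiSupp (biD₁ b) n := by
  intro j k hjk
  rw [_root_.biD₁, h _ _ (by omega), mul_zero]

theorem BiSupp.biD₂ {b : ℕ → ℕ → ℝ} {n : ℕ} (h : BiSupp b n) : BiSupp (biD₂ b) n := by
  intro j k hjk
  rw [_root_.biD₂, h _ _ (by omega), mul_zero]

theorem BiBound.nonneg {b : ℕ → ℕ → ℝ} {M r : ℝ} (h : BiBound b M r) : 0 ≤ M := by
  simpa using (abs_nonneg _).trans (h 0 0)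

theorem BiBound.biD₁ {b : ℕ → ℕ → ℝ} {M r : ℝ} (hr : 0 < r) (h : BiBound b M r) :
    BiBound (biD₁ b) (M / r) (r / 2) := by
  intro j k
  have hM := h.nonneg
  have h2 : ((j : ℝ) + 1) ≤ 2 ^ (j + k) := by
    have h3 : j + 1 ≤ 2 ^ (j + k) :=
      (Nat.lt_two_pow_self).trans_le (Nat.pow_le_pow_right (by norm_num) (by omega))
    exact_mod_cast h3
  rw [_root_.biD₁, abs_mul, abs_of_nonneg (by positivity : (0 : ℝ) ≤ (j : ℝ) + 1)]
  calc ((j : ℝ) + 1) * |b (j + 1) k| ≤ 2 ^ (j + k) * (M / r ^ (j + 1 + k)) := by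
        gcongr
        exact h _ _
    _ = M / r / (r / 2) ^ (j + k) := by
        rw [div_pow, show j + 1 + k = j + k + 1 by ring, pow_succ]
        field_simp

theorem BiBound.biD₂ {b : ℕ → ℕ → ℝ} {M r : ℝ} (hr : 0 < r) (h : BiBound b M r) :
    BiBound (biD₂ b) (M / r) (r / 2) := by
  intro j k
  have hM := h.nonneg
  have h2 : ((k : ℝ) + 1) ≤ 2 ^ (j + k) := by
    have h3 : k + 1 ≤ 2 ^ (j + k) :=
      (Nat.lt_two_pow_self).trans_le (Nat.pow_le_pow_right (by norm_num) (by omega))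
    exact_mod_cast h3
  rw [_root_.biD₂, abs_mul, abs_of_nonneg (by positivity : (0 : ℝ) ≤ (k : ℝ) + 1)]
  calc ((k : ℝ) + 1) * |b j (k + 1)| ≤ 2 ^ (j + k) * (M / r ^ (j + (k + 1))) := by
        gcongr
        exact h _ _
    _ = M / r / (r / 2) ^ (j + k) := by
        rw [div_pow, ← add_assoc, pow_succ]
        field_simp

theorem BiBound.abs_biEval_le {b : ℕ → ℕ → ℝ} {M r : ℝ} (hr : 0 < r) (h : BiBound b M r) (n : ℕ)
    {p : ℝ × ℝ} (hp : ‖p‖ ≤ r / 2) : |biEval b n p| ≤ 4 * M := by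
  have hM := h.nonneg
  have h1 : |p.1| ≤ r / 2 := (norm_fst_le p).trans hp
  have h2 : |p.2| ≤ r / 2 := (norm_snd_le p).trans hp
  have hgeom : ∑ j ∈ Finset.range n, ((1 : ℝ) / 2) ^ j ≤ 2 := sum_geometric_two_le n
  calc |biEval b n p| ≤ ∑ j ∈ Finset.range n, ∑ k ∈ Finset.range n,
        M * ((1 / 2) ^ j * (1 / 2) ^ k) := by
        unfold biEval
        refine (Finset.abs_sum_le_sum_abs _ _).trans (Finset.sum_le_sum fun j _ => ?_)
        refine (Finset.abs_sum_le_sum_abs _ _).trans (Finset.sum_le_sum fun k _ => ?_)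
        rw [abs_mul, abs_mul, abs_pow, abs_pow]
        calc |b j k| * |p.1| ^ j * |p.2| ^ k
            ≤ (M / r ^ (j + k)) * (r / 2) ^ j * (r / 2) ^ k := by
              gcongr
              exact h j k
          _ = M * ((1 / 2) ^ j * (1 / 2) ^ k) := by
              rw [div_pow, div_pow, div_pow, div_pow, pow_add]
              field_simp
              simp
    _ = M * ((∑ j ∈ Finset.range n, ((1 : ℝ) / 2) ^ j) *
          ∑ k ∈ Finset.range n, ((1 : ℝ) / 2) ^ k) := by
        simp_rw [← Finset.mul_sum, ← Finset.sum_mul]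
    _ ≤ M * (2 * 2) := by
        have : (0 : ℝ) ≤ ∑ k ∈ Finset.range n, ((1 : ℝ) / 2) ^ k :=
          Finset.sum_nonneg fun _ _ => by positivity
        gcongr
    _ = 4 * M := by ring

theorem sum_range_natCast_mul_shift (n : ℕ) (c : ℕ → ℝ) (hc : c n = 0) (u : ℝ) :
    ∑ j ∈ Finset.range n, c j * (j * u ^ (j - 1)) =
      ∑ j ∈ Finset.range n, ((j + 1) * c (j + 1)) * u ^ j := by
  cases n with
  | zero => simp
  | succ m =>
    rw [Finset.sum_range_succ', Finset.sum_range_succ _ m, hc]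
    simp only [Nat.cast_zero, zero_mul, mul_zero, add_zero]
    refine Finset.sum_congr rfl fun j _ => ?_
    push_cast
    ring_nf

theorem hasStrictFDerivAt_biEval {b : ℕ → ℕ → ℝ} {n : ℕ} (hb : BiSupp b n) (p : ℝ × ℝ) :
    HasStrictFDerivAt (biEval b n) (biEval (biD₁ b) n p • ContinuousLinearMap.fst ℝ ℝ ℝ +
      biEval (biD₂ b) n p • ContinuousLinearMap.snd ℝ ℝ ℝ) p := by
  have hterm : ∀ j k : ℕ, HasStrictFDerivAt (fun q : ℝ × ℝ => b j k * q.1 ^ j * q.2 ^ k)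
      ((b j k * (j * p.1 ^ (j - 1)) * p.2 ^ k) • ContinuousLinearMap.fst ℝ ℝ ℝ +
        (b j k * p.1 ^ j * (k * p.2 ^ (k - 1))) • ContinuousLinearMap.snd ℝ ℝ ℝ) p := by
    intro j k
    have h1 : HasStrictFDerivAt (fun q : ℝ × ℝ => q.1 ^ j) _ p :=
      (hasStrictFDerivAt_fst (𝕜 := ℝ) (p := p)).pow j
    have h2 : HasStrictFDerivAt (fun q : ℝ × ℝ => q.2 ^ k) _ p :=
      (hasStrictFDerivAt_snd (𝕜 := ℝ) (p := p)).pow k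
    refine ((h1.const_mul (b j k)).mul h2).congr_fderiv ?_
    ext <;> simp
    ring
  have hsum := HasStrictFDerivAt.fun_sum (u := Finset.range n) fun j _ =>
    HasStrictFDerivAt.fun_sum (u := Finset.range n) fun k _ => hterm j k
  refine hsum.congr_fderiv ?_
  simp_rw [Finset.sum_add_distrib, ← Finset.sum_smul]
  congr 2
  · unfold biEval
    rw [Finset.sum_comm, Finset.sum_comm (f := fun j k => biD₁ b j k * p.1 ^ j * p.2 ^ k)]
    refine Finset.sum_congr rfl fun k _ => ?_
    rw [← Finset.sum_mul, ← Finset.sum_mul,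
      sum_range_natCast_mul_shift n (fun j => b j k) (hb _ _ (Or.inl le_rfl))]
    rfl
  · unfold biEval
    refine Finset.sum_congr rfl fun j _ => ?_
    have := sum_range_natCast_mul_shift n (fun k => b j k) (hb _ _ (Or.inr le_rfl)) p.2
    calc _ = p.1 ^ j * ∑ k ∈ Finset.range n, b j k * (k * p.2 ^ (k - 1)) := by
          rw [Finset.mul_sum]
          exact Finset.sum_congr rfl fun k _ => by ring
      _ = _ := by
          rw [this, Finset.mul_sum]
          exact Finset.sum_congr rfl fun k _ => by rw [biD₂]; ring

theorem norm_smul_fst_add_smul_snd_le (x y : ℝ) :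
    ‖x • ContinuousLinearMap.fst ℝ ℝ ℝ + y • ContinuousLinearMap.snd ℝ ℝ ℝ‖ ≤ |x| + |y| := by
  refine ContinuousLinearMap.opNorm_le_bound _ (by positivity) fun q => ?_
  have h1 : |q.1| ≤ ‖q‖ := norm_fst_le q
  have h2 : |q.2| ≤ ‖q‖ := norm_snd_le q
  simp only [add_apply, smul_apply,
    ContinuousLinearMap.coe_fst', ContinuousLinearMap.coe_snd', smul_eq_mul, Real.norm_eq_abs]
  calc |x * q.1 + y * q.2| ≤ |x| * |q.1| + |y| * |q.2| := by
        rw [← abs_mul, ← abs_mul]; exact abs_add_le _ _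
    _ ≤ (|x| + |y|) * ‖q‖ := by rw [add_mul]; gcongr

theorem BiBound.abs_biEval_sub_le {b : ℕ → ℕ → ℝ} {M r : ℝ} {n : ℕ} (hr : 0 < r)
    (h : BiBound b M r) (hb : BiSupp b n) {p q : ℝ × ℝ} (hp : ‖p‖ ≤ r / 4) (hq : ‖q‖ ≤ r / 4) :
    |biEval b n p - biEval b n q| ≤ 8 * M / r * ‖p - q‖ := by
  refine (convex_closedBall (0 : ℝ × ℝ) (r / 4)).norm_image_sub_le_of_norm_hasFDerivWithin_le
    (fun x _ => (hasStrictFDerivAt_biEval hb x).hasFDerivAt.hasFDerivWithinAt) (fun x hx => ?_)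
    (mem_closedBall_zero_iff.2 hq) (mem_closedBall_zero_iff.2 hp)
  rw [mem_closedBall_zero_iff] at hx
  refine (norm_smul_fst_add_smul_snd_le _ _).trans ?_
  have h1 := (h.biD₁ hr).abs_biEval_le (by positivity) n (p := x) (by linarith)
  have h2 := (h.biD₂ hr).abs_biEval_le (by positivity) n (p := x) (by linarith)
  calc _ ≤ 4 * (M / r) + 4 * (M / r) := add_le_add h1 h2
    _ = 8 * M / r := by ring

theorem norm_coeff_le_of_forall_norm_eq {c : ℕ → ℂ} {n : ℕ} {r S : ℝ} (hr : 0 < r)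
    (h : ∀ z : ℂ, ‖z‖ = r → ‖∑ k ∈ Finset.range n, c k * z ^ k‖ ≤ S) {k : ℕ} (hk : k < n) :
    ‖c k‖ ≤ S / r ^ k := by
  set p : Polynomial ℂ := ∑ i ∈ Finset.range n, Polynomial.monomial i (c i) with hp
  have heval : ∀ z, p.eval z = ∑ i ∈ Finset.range n, c i * z ^ i := fun z => by
    simp [hp, Polynomial.eval_finsetSum]
  have hcoeff : p.coeff k = c k := by
    simp [hp, Polynomial.finsetSum_coeff, Polynomial.coeff_monomial, hk]
  have h1 := Complex.norm_iteratedDeriv_le_of_forall_mem_sphere_norm_le (c := 0) (C := S) k hr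
    (p.differentiable.diffContOnCl) (fun z hz => by
      rw [heval]
      exact h z (by simpa using hz))
  have h2 : iteratedDeriv k (fun z => p.eval z) 0 = k.factorial * c k := by
    rw [iteratedDeriv_eq_iterate, ← hcoeff]
    have : ∀ m (q : Polynomial ℂ), deriv^[m] (fun z => q.eval z) =
        fun z => (Polynomial.derivative^[m] q).eval z := by
      intro m
      induction m with
      | zero => intro q; rfl
      | succ m ih =>
        intro q
        rw [Function.iterate_succ_apply, Function.iterate_succ_apply, ← ih]
        congr 1
        ext z
        exact q.deriv
    rw [this]
    simp only [← Polynomial.coeff_zero_eq_eval_zero]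
    rw [Polynomial.coeff_iterate_derivative]
    simp [Nat.descFactorial_self]
  rw [h2, norm_mul, Complex.norm_natCast, mul_div_assoc] at h1
  exact le_of_mul_le_mul_left h1 (by positivity)

theorem BiBound.of_norm_le {b : ℕ → ℕ → ℝ} {n : ℕ} (hb : BiSupp b n) {r S : ℝ} (hr : 0 < r)
    (h : ∀ u v : ℂ, ‖u‖ = r → ‖v‖ = r →
      ‖∑ j ∈ Finset.range n, ∑ k ∈ Finset.range n, (b j k : ℂ) * u ^ j * v ^ k‖ ≤ S) :
    BiBound b S r := by
  have hS : 0 ≤ S := (norm_nonneg _).trans (h r r (by simp [hr.le]) (by simp [hr.le]))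
  intro j k
  by_cases hjk : n ≤ j ∨ n ≤ k
  · rw [hb _ _ hjk, abs_zero]
    positivity
  push Not at hjk
  have h1 : ∀ u : ℂ, ‖u‖ = r → ‖∑ j ∈ Finset.range n, (b j k : ℂ) * u ^ j‖ ≤ S / r ^ k := by
    intro u hu
    refine norm_coeff_le_of_forall_norm_eq
      (c := fun k => ∑ j ∈ Finset.range n, (b j k : ℂ) * u ^ j) hr (fun v hv => ?_) hjk.2
    have := h u v hu hv
    rw [Finset.sum_comm] at this
    simpa only [Finset.sum_mul] using this
  have h2 := norm_coeff_le_of_forall_norm_eq (c := fun j => (b j k : ℂ)) hr h1 hjk.1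
  rw [Complex.norm_real, Real.norm_eq_abs, div_div, ← pow_add] at h2
  rwa [add_comm j k]

/-- Coefficients of the Kostlan form in the affine chart `(u, v) ↦ Q + u E + v F`. -/
noncomputable def chartCoeff (d : ℕ) (Q E F : Fin 3 → ℝ) (a : degIndex d → ℝ) (j k : ℕ) : ℝ :=
  ((kostlanForm d a (fun i => (Polynomial.C (Polynomial.C (Q i) + Polynomial.C (E i) *
    Polynomial.X) + Polynomial.C (Polynomial.C (F i)) * Polynomial.X :
      Polynomial (Polynomial ℝ)))).coeff k).coeff j

theorem chartCoeff_add (d : ℕ) (Q E F : Fin 3 → ℝ) (a a' : degIndex d → ℝ) :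
    chartCoeff d Q E F (a + a') = chartCoeff d Q E F a + chartCoeff d Q E F a' := by
  ext j k
  simp [chartCoeff, kostlanForm, add_mul, Finset.sum_add_distrib]

theorem chartCoeff_smul (d : ℕ) (Q E F : Fin 3 → ℝ) (t : ℝ) (a : degIndex d → ℝ) :
    chartCoeff d Q E F (t • a) = t • chartCoeff d Q E F a := by
  ext j k
  simp only [chartCoeff, kostlanForm, Pi.smul_apply, smul_eq_mul, mul_assoc, map_mul,
    ← Finset.mul_sum]
  simp [Polynomial.algebraMap_apply]

theorem exists_forall_coeff_coeff_eq_zero (P : Polynomial (Polynomial ℝ)) :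
    ∃ n, ∀ j k, n ≤ j ∨ n ≤ k → (P.coeff k).coeff j = 0 := by
  refine ⟨max (P.natDegree + 1) (P.support.sup (fun k => (P.coeff k).natDegree) + 1),
    fun j k h => ?_⟩
  by_cases hk : k ∈ P.support
  · refine Polynomial.coeff_eq_zero_of_natDegree_lt ?_
    have h1 := Finset.le_sup (f := fun k => (P.coeff k).natDegree) hk
    have h2 := Polynomial.le_natDegree_of_mem_supp _ hk
    omega
  · rw [Polynomial.notMem_support_iff.1 hk, Polynomial.coeff_zero]

theorem exists_biSupp_chartCoeff (d : ℕ) (Q E F : Fin 3 → ℝ) :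
    ∃ n, ∀ a, BiSupp (chartCoeff d Q E F a) n := by
  choose n hn using fun p : degIndex d => exists_forall_coeff_coeff_eq_zero
    ((fun X : Fin 3 → Polynomial (Polynomial ℝ) => X 0 ^ (p.1.1 : ℕ) * X 1 ^ (p.1.2 : ℕ) *
      X 2 ^ (d - (p.1.1 : ℕ) - (p.1.2 : ℕ)))
    (fun i => (Polynomial.C (Polynomial.C (Q i) + Polynomial.C (E i) *
    Polynomial.X) + Polynomial.C (Polynomial.C (F i)) * Polynomial.X)))
  refine ⟨Finset.univ.sup n, fun a j k h => ?_⟩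
  simp only [chartCoeff, kostlanForm, Polynomial.algebraMap_apply, Polynomial.finsetSum_coeff,
    Polynomial.coeff_C_mul, Algebra.algebraMap_self, RingHom.id_apply]
  refine Finset.sum_eq_zero fun p _ => ?_
  have := Finset.le_sup (f := n) (Finset.mem_univ p)
  rw [hn p j k (by omega), mul_zero]

theorem aevalAeval_eq_sum {A : Type*} [CommRing A] [Algebra ℝ A] (P : Polynomial (Polynomial ℝ))
    {n : ℕ} (h : ∀ j k, n ≤ j ∨ n ≤ k → (P.coeff k).coeff j = 0) (u v : A) :
    Polynomial.aevalAeval (R := ℝ) u v P = ∑ j ∈ Finset.range n, ∑ k ∈ Finset.range n,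
      algebraMap ℝ A ((P.coeff k).coeff j) * u ^ j * v ^ k := by
  have hP : P = ∑ j ∈ Finset.range n, ∑ k ∈ Finset.range n,
      algebraMap ℝ _ ((P.coeff k).coeff j) * (Polynomial.C Polynomial.X) ^ j *
        Polynomial.X ^ k := by
    ext k j
    simp only [Polynomial.finsetSum_coeff, Polynomial.algebraMap_apply, mul_assoc,
      Polynomial.coeff_C_mul, ← Polynomial.C_pow, Polynomial.coeff_X_pow, Algebra.algebraMap_self,
      RingHom.id_apply, mul_ite, mul_one, mul_zero, apply_ite (fun q : Polynomial ℝ => q.coeff j),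
      Polynomial.coeff_zero, Finset.sum_ite_eq, Finset.mem_range]
    by_cases hjk : n ≤ j ∨ n ≤ k
    · rw [h j k hjk]
      symm
      refine Finset.sum_eq_zero fun i hi => ?_
      rw [Finset.mem_range] at hi
      split_ifs with h1 h2 <;> [skip; rfl; rfl]
      omega
    · push Not at hjk
      simp [hjk.1, hjk.2]
  conv_lhs => rw [hP]
  simp only [map_sum, map_mul, map_pow, AlgHom.commutes, Polynomial.aevalAeval_X,
    Polynomial.aevalAeval_Y]

theorem kostlanForm_chart {A : Type*} [CommRing A] [Algebra ℝ A] {d n : ℕ} {Q E F : Fin 3 → ℝ}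
    {a : degIndex d → ℝ} (h : BiSupp (chartCoeff d Q E F a) n) (u v : A) :
    kostlanForm d a (fun i => algebraMap ℝ A (Q i) + algebraMap ℝ A (E i) * u +
      algebraMap ℝ A (F i) * v) = ∑ j ∈ Finset.range n, ∑ k ∈ Finset.range n,
      algebraMap ℝ A (chartCoeff d Q E F a j k) * u ^ j * v ^ k := by
  unfold chartCoeff
  rw [← aevalAeval_eq_sum _ h, kostlanForm_map]
  congr 1
  ext i
  simp

theorem biEval_chartCoeff {d n : ℕ} {Q E F : Fin 3 → ℝ} {a : degIndex d → ℝ}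
    (h : BiSupp (chartCoeff d Q E F a) n) (p : ℝ × ℝ) :
    biEval (chartCoeff d Q E F a) n p =
      kostlanForm d a (fun i => Q i + E i * p.1 + F i * p.2) :=
  (kostlanForm_chart h p.1 p.2).symm

/-- Squared Hermitian norm in terms of an orthonormal real frame. -/
theorem sum_norm_frame_sq {Q E F : Fin 3 → ℝ} (hQ : ∑ i, Q i ^ 2 = 1) (hE : ∑ i, E i ^ 2 = 1)
    (hF : ∑ i, F i ^ 2 = 1) (hQE : ∑ i, Q i * E i = 0) (hQF : ∑ i, Q i * F i = 0)
    (hEF : ∑ i, E i * F i = 0) (u v : ℂ) :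
    ∑ i, ‖(Q i : ℂ) + E i * u + F i * v‖ ^ 2 = 1 + ‖u‖ ^ 2 + ‖v‖ ^ 2 := by
  have h : ∀ i, ‖(Q i : ℂ) + E i * u + F i * v‖ ^ 2 = Q i ^ 2 + E i ^ 2 * ‖u‖ ^ 2 +
      F i ^ 2 * ‖v‖ ^ 2 + 2 * u.re * (Q i * E i) + 2 * v.re * (Q i * F i) +
      2 * (u.re * v.re + u.im * v.im) * (E i * F i) := by
    intro i
    rw [← Complex.normSq_eq_norm_sq, ← Complex.normSq_eq_norm_sq, ← Complex.normSq_eq_norm_sq,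
      Complex.normSq_apply, Complex.normSq_apply, Complex.normSq_apply]
    simp
    ring
  simp_rw [h, Finset.sum_add_distrib, ← Finset.sum_mul, ← Finset.mul_sum, hQ, hE, hF, hQE, hQF,
    hEF]
  ring

theorem biBound_chartCoeff {d n : ℕ} {Q E F : Fin 3 → ℝ} (hQ : ∑ i, Q i ^ 2 = 1)
    (hE : ∑ i, E i ^ 2 = 1) (hF : ∑ i, F i ^ 2 = 1) (hQE : ∑ i, Q i * E i = 0)
    (hQF : ∑ i, Q i * F i = 0) (hEF : ∑ i, E i * F i = 0) {a : degIndex d → ℝ}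
    (h : BiSupp (chartCoeff d Q E F a) n) {R r : ℝ} (hR : 0 ≤ R) (ha : ∑ i, a i ^ 2 ≤ R ^ 2)
    (hr : 0 < r) :
    BiBound (chartCoeff d Q E F a) (R * (d + 2) * Real.exp (d * r ^ 2)) r := by
  refine BiBound.of_norm_le h hr fun u v hu hv => ?_
  have h1 := kostlanForm_chart h u v
  simp only [Complex.coe_algebraMap] at h1
  rw [← h1]
  refine abs_le_of_sq_le_sq' ?_ (by positivity) |>.2
  refine (norm_kostlanForm_sq_le _ _ _).trans ?_
  have h2 := sum_norm_frame_sq hQ hE hF hQE hQF hEF u v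
  rw [Fin.sum_univ_three, hu, hv] at h2
  rw [h2, mul_pow, mul_pow, mul_assoc]
  have h3 : 1 + r ^ 2 + r ^ 2 ≤ Real.exp (r ^ 2) ^ 2 := by
    rw [← Real.exp_nat_mul]
    have := Real.add_one_le_exp (2 * r ^ 2)
    push_cast
    linarith
  have h4 : Real.exp (d * r ^ 2) ^ 2 = (Real.exp (r ^ 2) ^ 2) ^ d := by
    rw [Real.exp_nat_mul, ← pow_mul, ← pow_mul, mul_comm]
  rw [h4]
  have hd : (0 : ℝ) ≤ d := d.cast_nonneg
  gcongr
  nlinarith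

theorem two_mul_finrank_restrictTotalDegree (m : ℕ) :
    2 * Module.finrank ℝ (MvPolynomial.restrictTotalDegree (Fin 2) ℝ m) = (m + 1) * (m + 2) := by
  have h1 : Module.finrank ℝ (MvPolynomial.restrictTotalDegree (Fin 2) ℝ m) =
      Nat.card {n : Fin 2 →₀ ℕ | (n.sum fun _ e => e) ≤ m} :=
    Module.finrank_eq_nat_card_basis (MvPolynomial.basisRestrictSupport ℝ _)
  have h2 : Nat.card {n : Fin 2 →₀ ℕ | (n.sum fun _ e => e) ≤ m} =
      ((Finset.range (m + 1)).sigma fun k => Finset.HasAntidiagonal.antidiagonal k).card := by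
    rw [Nat.card_coe_set_eq, ← Set.ncard_coe_finset]
    refine Set.ncard_congr (fun n _ => ⟨n 0 + n 1, (n 0, n 1)⟩) ?_ ?_ ?_
    · intro n hn
      rw [Set.mem_ofPred_eq, Finsupp.sum_fintype _ _ (fun _ => rfl), Fin.sum_univ_two] at hn
      simp
      omega
    · intro n n' _ _ h
      simp only [Sigma.mk.injEq, heq_eq_eq, Prod.mk.injEq] at h
      ext i
      fin_cases i
      · exact h.2.1
      · exact h.2.2
    · rintro ⟨k, x, y⟩ h
      simp only [Finset.coe_sigma, Finset.coe_range, Set.mem_sigma_iff, Set.mem_Iio,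
        Finset.mem_coe, Finset.HasAntidiagonal.mem_antidiagonal] at h
      obtain ⟨h, rfl⟩ := h
      refine ⟨Finsupp.equivFunOnFinite.symm ![x, y], ?_, ?_⟩
      · simp [Finsupp.sum_fintype]
        omega
      · simp
  rw [h1, h2, Finset.card_sigma]
  simp only [Finset.Nat.card_antidiagonal]
  have h3 := Finset.sum_range_id_mul_two (m + 2)
  rw [Finset.sum_range_succ'] at h3
  simp only [add_zero] at h3
  rw [mul_comm, h3, show m + 2 - 1 = m + 1 from rfl, mul_comm]

theorem exists_eval_eq_of_finset (S : Finset (Fin 2 → ℝ)) (c : S → ℝ) :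
    ∃ P : MvPolynomial (Fin 2) ℝ, P.totalDegree ≤ S.card ∧
      ∀ p : S, MvPolynomial.eval (p : Fin 2 → ℝ) P = c p := by
  classical
  have h : ∀ p ∈ S, ∃ P : MvPolynomial (Fin 2) ℝ, P.totalDegree ≤ S.card ∧
      MvPolynomial.eval p P ≠ 0 ∧ ∀ q ∈ S, q ≠ p → MvPolynomial.eval q P = 0 := by
    intro p _
    have hi : ∀ q : Fin 2 → ℝ, ∃ i, q ≠ p → p i ≠ q i := by
      intro q
      by_cases hq : q = p
      · exact ⟨0, fun h => absurd hq h⟩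
      · obtain ⟨i, hi⟩ := Function.ne_iff.1 hq
        exact ⟨i, fun _ => hi.symm⟩
    choose i hi using hi
    refine ⟨∏ q ∈ S.erase p, (MvPolynomial.X (i q) - MvPolynomial.C (q (i q))), ?_, ?_, ?_⟩
    · refine (MvPolynomial.totalDegree_finsetProd _ _).trans ?_
      refine (Finset.sum_le_card_nsmul _ _ 1 fun q _ => ?_).trans ?_
      · refine (MvPolynomial.totalDegree_sub_C_le _ _).trans ?_
        simp [MvPolynomial.totalDegree_X]
      · simpa using Finset.card_le_card (Finset.erase_subset p S)
    · rw [map_prod, Finset.prod_ne_zero_iff]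
      intro q hq
      simpa [sub_eq_zero] using hi q (Finset.ne_of_mem_erase hq)
    · intro q hq hqp
      rw [map_prod]
      exact Finset.prod_eq_zero (Finset.mem_erase.2 ⟨hqp, hq⟩) (by simp)
  choose! P hP1 hP2 hP3 using h
  refine ⟨∑ p : S, MvPolynomial.C (c p / MvPolynomial.eval (p : Fin 2 → ℝ) (P p)) * P p, ?_, ?_⟩
  · refine MvPolynomial.totalDegree_finsetSum_le fun p _ => ?_
    refine (MvPolynomial.totalDegree_mul _ _).trans ?_
    simpa using hP1 p p.2
  · intro q
    rw [map_sum, Finset.sum_eq_single q]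
    · simp [hP2 q q.2]
    · intro p _ hpq
      rw [map_mul, hP3 p p.2 q q.2 (fun h => hpq (Subtype.ext h.symm)), mul_zero]
    · simp

/-- Bezout's bound for the number of common zeros of two coprime plane curves. -/
theorem card_le_of_isRelPrime {F G : MvPolynomial (Fin 2) ℝ} (hG : G ≠ 0)
    (h : IsRelPrime F G) (S : Finset (Fin 2 → ℝ))
    (hS : ∀ p ∈ S, MvPolynomial.eval p F = 0 ∧ MvPolynomial.eval p G = 0) :
    S.card ≤ F.totalDegree * G.totalDegree := by
  set f := F.totalDegree with hf
  set g := G.totalDegree with hg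
  set n := S.card with hn
  let V := fun m => MvPolynomial.restrictTotalDegree (Fin 2) ℝ m
  have hV : ∀ m (P : MvPolynomial (Fin 2) ℝ), P ∈ V m ↔ P.totalDegree ≤ m := fun m P =>
    MvPolynomial.mem_restrictTotalDegree _ _ _
  let ev : V (f + g + n) →ₗ[ℝ] (S → ℝ) := LinearMap.pi fun p =>
    (MvPolynomial.aeval (p : Fin 2 → ℝ)).toLinearMap ∘ₗ (V (f + g + n)).subtype
  have hev : Function.Surjective ev := by
    intro c
    obtain ⟨P, hP1, hP2⟩ := exists_eval_eq_of_finset S c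
    refine ⟨⟨P, (hV _ _).2 (hP1.trans (by omega))⟩, funext fun p => ?_⟩
    simpa [ev, MvPolynomial.aeval_eq_eval] using hP2 p
  let Φ₀ : V (g + n) × V (f + n) →ₗ[ℝ] MvPolynomial (Fin 2) ℝ :=
    (LinearMap.mulLeft ℝ F ∘ₗ (V (g + n)).subtype).coprod
      (LinearMap.mulLeft ℝ G ∘ₗ (V (f + n)).subtype)
  have hΦ₀ : ∀ x, Φ₀ x = F * x.1 + G * x.2 := fun x => rfl
  let Φ : V (g + n) × V (f + n) →ₗ[ℝ] V (f + g + n) := Φ₀.codRestrict _ (by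
    intro x
    have h1 := (hV _ _).1 x.1.2
    have h2 := (hV _ _).1 x.2.2
    rw [hΦ₀, hV]
    refine (MvPolynomial.totalDegree_add _ _).trans (max_le ?_ ?_)
    · refine (MvPolynomial.totalDegree_mul _ _).trans ?_
      omega
    · refine (MvPolynomial.totalDegree_mul _ _).trans ?_
      omega)
  have hrange : LinearMap.range Φ ≤ LinearMap.ker ev := by
    rintro _ ⟨x, rfl⟩
    rw [LinearMap.mem_ker]
    ext p
    have := hS p p.2
    change MvPolynomial.aeval (p : Fin 2 → ℝ) (F * x.1 + G * x.2 : MvPolynomial (Fin 2) ℝ) = 0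
    simp [MvPolynomial.aeval_eq_eval, this.1, this.2]
  let Ψ : V n →ₗ[ℝ] MvPolynomial (Fin 2) ℝ × MvPolynomial (Fin 2) ℝ :=
    ((LinearMap.mulLeft ℝ G).prod (-LinearMap.mulLeft ℝ F)) ∘ₗ (V n).subtype
  let ι : V (g + n) × V (f + n) →ₗ[ℝ] MvPolynomial (Fin 2) ℝ × MvPolynomial (Fin 2) ℝ :=
    (V (g + n)).subtype.prodMap (V (f + n)).subtype
  have hι : Function.Injective ι :=
    Prod.map_injective.2 ⟨Subtype.val_injective, Subtype.val_injective⟩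
  have hker : (LinearMap.ker Φ).map ι ≤ LinearMap.range Ψ := by
    rintro _ ⟨⟨⟨A, hA⟩, ⟨B, hB⟩⟩, hx, rfl⟩
    have h1 : F * A + G * B = 0 := congrArg Subtype.val (LinearMap.mem_ker.1 hx)
    have h2 : G ∣ A := by
      refine h.symm.dvd_of_dvd_mul_left ⟨-B, ?_⟩
      linear_combination h1
    obtain ⟨C, rfl⟩ := h2
    have h3 : B = -(F * C) := mul_left_cancel₀ hG (by linear_combination h1)
    refine ⟨⟨C, (hV _ _).2 ?_⟩, ?_⟩
    · rcases eq_or_ne C 0 with rfl | hC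
      · simp
      · have := (hV _ _).1 hA
        rw [MvPolynomial.totalDegree_mul_of_isDomain hG hC] at this
        omega
    · simp [Ψ, ι, h3]
  have : ∀ m, Module.Finite ℝ (V m) := fun m => inferInstanceAs
    (Module.Finite ℝ (MvPolynomial.restrictTotalDegree (Fin 2) ℝ m))
  have e1 := LinearMap.finrank_range_add_finrank_ker Φ
  have e2 := LinearMap.finrank_range_add_finrank_ker ev
  have e3 := Submodule.finrank_mono hrange
  have e4 : Module.finrank ℝ (LinearMap.ker Φ) ≤ Module.finrank ℝ (V n) := by
    rw [(Submodule.equivMapOfInjective ι hι _).finrank_eq]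
    exact (Submodule.finrank_mono hker).trans (LinearMap.finrank_range_le Ψ)
  rw [LinearMap.range_eq_top.2 hev, finrank_top, Module.finrank_fintype_fun_eq_card,
    Fintype.card_coe] at e2
  rw [Module.finrank_prod] at e1
  have d1 := two_mul_finrank_restrictTotalDegree (g + n)
  have d2 := two_mul_finrank_restrictTotalDegree (f + n)
  have d3 := two_mul_finrank_restrictTotalDegree (f + g + n)
  have d4 := two_mul_finrank_restrictTotalDegree n
  change 2 * Module.finrank ℝ (V _) = _ at d1 d2 d3 d4
  nlinarith

theorem finite_setOf_not_isRelPrime_sub_C {σ : Type*} (P : MvPolynomial σ ℝ)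
    {Q : MvPolynomial σ ℝ} (hQ : Q ≠ 0) :
    {c : ℝ | ¬ IsRelPrime (P - MvPolynomial.C c) Q}.Finite := by
  classical
  have h : ∀ c : ℝ, ¬ IsRelPrime (P - MvPolynomial.C c) Q →
      ∃ q ∈ UniqueFactorizationMonoid.factors Q, q ∣ P - MvPolynomial.C c := by
    intro c hc
    simp only [IsRelPrime, not_forall] at hc
    obtain ⟨e, he1, he2, he3⟩ := hc
    have he0 : e ≠ 0 := fun h0 => hQ (zero_dvd_iff.1 (h0 ▸ he2))
    obtain ⟨i, hi, hie⟩ := WfDvdMonoid.exists_irreducible_factor he3 he0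
    obtain ⟨q, hq, hiq⟩ := UniqueFactorizationMonoid.exists_mem_factors_of_dvd hQ hi
      (hie.trans he2)
    exact ⟨q, hq, hiq.dvd'.trans (hie.trans he1)⟩
  choose! q hq1 hq2 using h
  refine Set.Finite.of_injOn (f := q) (t := ↑(UniqueFactorizationMonoid.factors Q).toFinset)
    (fun c hc => ?_) (fun c hc c' hc' hcc => ?_) (Finset.finite_toSet _)
  · simpa using hq1 c hc
  · by_contra hne
    have h1 : q c ∣ MvPolynomial.C (c' - c) := by
      have h2 := dvd_sub (hq2 c hc) (hcc ▸ hq2 c' hc')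
      simpa using h2
    exact (UniqueFactorizationMonoid.irreducible_of_factor _ (hq1 c hc)).not_isUnit
      (isUnit_of_dvd_unit h1 ((isUnit_iff_ne_zero.2 (sub_ne_zero.2 (Ne.symm hne))).map
        MvPolynomial.C))

theorem biEval_add (b c : ℕ → ℕ → ℝ) (n : ℕ) (p : ℝ × ℝ) :
    biEval (b + c) n p = biEval b n p + biEval c n p := by
  simp [biEval, add_mul, Finset.sum_add_distrib]

theorem biD₁_add (b c : ℕ → ℕ → ℝ) : biD₁ (b + c) = biD₁ b + biD₁ c := by
  ext j k
  simp [biD₁, mul_add]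

theorem biD₂_add (b c : ℕ → ℕ → ℝ) : biD₂ (b + c) = biD₂ b + biD₂ c := by
  ext j k
  simp [biD₂, mul_add]

theorem BiBound.mono {b : ℕ → ℕ → ℝ} {M M' r r' : ℝ} (h : BiBound b M r) (hM : M ≤ M')
    (hr' : 0 < r') (hr : r' ≤ r) : BiBound b M' r' := by
  intro j k
  have := h.nonneg
  have := h.nonneg.trans hM
  exact (h j k).trans (by gcongr)

/-- The two-variable polynomial with coefficients `b j k`. -/
noncomputable def biPoly (b : ℕ → ℕ → ℝ) (n : ℕ) : MvPolynomial (Fin 2) ℝ :=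
  ∑ j ∈ Finset.range n, ∑ k ∈ Finset.range n,
    MvPolynomial.C (b j k) * MvPolynomial.X 0 ^ j * MvPolynomial.X 1 ^ k

theorem eval_biPoly (b : ℕ → ℕ → ℝ) (n : ℕ) (p : ℝ × ℝ) :
    MvPolynomial.eval ![p.1, p.2] (biPoly b n) = biEval b n p := by
  simp [biPoly, biEval]

theorem totalDegree_biPoly_le {b : ℕ → ℕ → ℝ} {L : ℕ} (n : ℕ)
    (h : ∀ j k, L < j ∨ L < k → b j k = 0) : (biPoly b n).totalDegree ≤ 2 * L := by
  refine MvPolynomial.totalDegree_finsetSum_le fun j _ =>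
    MvPolynomial.totalDegree_finsetSum_le fun k _ => ?_
  by_cases hjk : L < j ∨ L < k
  · simp [h j k hjk]
  · refine (MvPolynomial.totalDegree_mul _ _).trans ((add_le_add_left
      (MvPolynomial.totalDegree_mul _ _) _).trans ?_)
    simp
    omega

theorem approximatesLinearOn_prodMk {g h g₁ g₂ h₁ h₂ : ℝ × ℝ → ℝ}
    (hg : ∀ q, HasStrictFDerivAt g (g₁ q • ContinuousLinearMap.fst ℝ ℝ ℝ +
      g₂ q • ContinuousLinearMap.snd ℝ ℝ ℝ) q)
    (hh : ∀ q, HasStrictFDerivAt h (h₁ q • ContinuousLinearMap.fst ℝ ℝ ℝ +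
      h₂ q • ContinuousLinearMap.snd ℝ ℝ ℝ) q) {p : ℝ × ℝ} {ρ x y z w : ℝ} {c : NNReal}
    (H : ∀ q, ‖q - p‖ ≤ ρ → |g₁ q - x| ≤ c / 2 ∧ |g₂ q - y| ≤ c / 2 ∧
      |h₁ q - z| ≤ c / 2 ∧ |h₂ q - w| ≤ c / 2) :
    ApproximatesLinearOn (fun q => (g q, h q))
      ((x • ContinuousLinearMap.fst ℝ ℝ ℝ + y • ContinuousLinearMap.snd ℝ ℝ ℝ).prod
        (z • ContinuousLinearMap.fst ℝ ℝ ℝ + w • ContinuousLinearMap.snd ℝ ℝ ℝ))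
      (Metric.closedBall p ρ) c := by
  intro q hq q' hq'
  refine (convex_closedBall p ρ).norm_image_sub_le_of_norm_hasFDerivWithin_le'
    (fun a _ => ((hg a).prodMk (hh a)).hasFDerivAt.hasFDerivWithinAt) (fun a ha => ?_) hq' hq
  obtain ⟨h1, h2, h3, h4⟩ := H a (by simpa [dist_eq_norm] using ha)
  have e : ∀ x y z w : ℝ, x • ContinuousLinearMap.fst ℝ ℝ ℝ + y • ContinuousLinearMap.snd ℝ ℝ ℝ -
      (z • ContinuousLinearMap.fst ℝ ℝ ℝ + w • ContinuousLinearMap.snd ℝ ℝ ℝ) =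
      (x - z) • ContinuousLinearMap.fst ℝ ℝ ℝ + (y - w) • ContinuousLinearMap.snd ℝ ℝ ℝ := by
    intro x y z w
    module
  have e2 : ∀ A B C D : ℝ × ℝ →L[ℝ] ℝ, A.prod B - C.prod D = (A - C).prod (B - D) := by
    intros
    rfl
  rw [e2, e, e, ContinuousLinearMap.opNorm_prod, Prod.norm_mk]
  refine max_le ((norm_smul_fst_add_smul_snd_le _ _).trans ?_)
    ((norm_smul_fst_add_smul_snd_le _ _).trans ?_) <;> linarith

/-- Explicit inverse of a lower triangular planar linear map, with a norm bound. -/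
noncomputable def lowerTriangularRightInverse (x z w : ℝ) (hx : x ≠ 0) (hw : w ≠ 0) {K : NNReal}
    (hK1 : |x|⁻¹ ≤ K) (hK2 : (1 + |z| * |x|⁻¹) * |w|⁻¹ ≤ K) :
    ((x • ContinuousLinearMap.fst ℝ ℝ ℝ + (0 : ℝ) • ContinuousLinearMap.snd ℝ ℝ ℝ).prod
        (z • ContinuousLinearMap.fst ℝ ℝ ℝ +
          w • ContinuousLinearMap.snd ℝ ℝ ℝ)).NonlinearRightInverse where
  toFun q := (q.1 / x, (q.2 - z * (q.1 / x)) / w)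
  nnnorm := K
  bound' q := by
    have h1 : |q.1| ≤ ‖q‖ := norm_fst_le q
    have h2 : |q.2| ≤ ‖q‖ := norm_snd_le q
    refine max_le ?_ ?_
    · rw [Real.norm_eq_abs, abs_div, div_eq_inv_mul]
      gcongr
    · rw [Real.norm_eq_abs, abs_div, div_eq_mul_inv]
      calc |q.2 - z * (q.1 / x)| * |w|⁻¹ ≤ (|q.2| + |z| * (|q.1| * |x|⁻¹)) * |w|⁻¹ := by
            gcongr
            refine (abs_sub _ _).trans ?_
            rw [abs_mul, abs_div, div_eq_mul_inv]
        _ ≤ (‖q‖ + |z| * (‖q‖ * |x|⁻¹)) * |w|⁻¹ := by gcongr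
        _ = ((1 + |z| * |x|⁻¹) * |w|⁻¹) * ‖q‖ := by ring
        _ ≤ K * ‖q‖ := by gcongr
  right_inv' q := by
    ext
    · simp
      field_simp
    · simp
      field_simp
      ring

theorem exists_zero_near {g h g₁ g₂ h₁ h₂ : ℝ × ℝ → ℝ}
    (hg : ∀ q, HasStrictFDerivAt g (g₁ q • ContinuousLinearMap.fst ℝ ℝ ℝ +
      g₂ q • ContinuousLinearMap.snd ℝ ℝ ℝ) q)
    (hh : ∀ q, HasStrictFDerivAt h (h₁ q • ContinuousLinearMap.fst ℝ ℝ ℝ +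
      h₂ q • ContinuousLinearMap.snd ℝ ℝ ℝ) q) {p : ℝ × ℝ} {ρ x z w : ℝ} {c K : NNReal}
    (hρ : 0 ≤ ρ) (H : ∀ q, ‖q - p‖ ≤ ρ → |g₁ q - x| ≤ c / 2 ∧ |g₂ q - 0| ≤ c / 2 ∧
      |h₁ q - z| ≤ c / 2 ∧ |h₂ q - w| ≤ c / 2) (hx : x ≠ 0) (hw : w ≠ 0)
    (hK1 : |x|⁻¹ ≤ K) (hK2 : (1 + |z| * |x|⁻¹) * |w|⁻¹ ≤ K)
    (hgp : |g p| ≤ ((K : ℝ)⁻¹ - c) * ρ) (hhp : |h p| ≤ ((K : ℝ)⁻¹ - c) * ρ) :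
    ∃ q, ‖q - p‖ ≤ ρ ∧ g q = 0 ∧ h q = 0 := by
  have hsurj := (approximatesLinearOn_prodMk hg hh H).surjOn_closedBall_of_nonlinearRightInverse
    (lowerTriangularRightInverse x z w hx hw hK1 hK2) hρ subset_rfl
  have h0 : ((0 : ℝ), (0 : ℝ)) ∈ Metric.closedBall (g p, h p) (((K : ℝ)⁻¹ - c) * ρ) := by
    rw [Metric.mem_closedBall, dist_comm, dist_eq_norm]
    refine max_le ?_ ?_
    · simpa using hgp
    · simpa using hhp
  obtain ⟨q, hq1, hq2⟩ := hsurj h0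
  exact ⟨q, by simpa [dist_eq_norm] using hq1, congrArg Prod.fst hq2, congrArg Prod.snd hq2⟩

theorem eq_of_zero_near {g h g₁ g₂ h₁ h₂ : ℝ × ℝ → ℝ}
    (hg : ∀ q, HasStrictFDerivAt g (g₁ q • ContinuousLinearMap.fst ℝ ℝ ℝ +
      g₂ q • ContinuousLinearMap.snd ℝ ℝ ℝ) q)
    (hh : ∀ q, HasStrictFDerivAt h (h₁ q • ContinuousLinearMap.fst ℝ ℝ ℝ +
      h₂ q • ContinuousLinearMap.snd ℝ ℝ ℝ) q) {p q : ℝ × ℝ} {ρ x z w : ℝ} {c K : NNReal}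
    (hρ : 0 ≤ ρ) (H : ∀ q, ‖q - p‖ ≤ ρ → |g₁ q - x| ≤ c / 2 ∧ |g₂ q - 0| ≤ c / 2 ∧
      |h₁ q - z| ≤ c / 2 ∧ |h₂ q - w| ≤ c / 2) (hx : x ≠ 0) (hw : w ≠ 0)
    (hK1 : |x|⁻¹ ≤ K) (hK2 : (1 + |z| * |x|⁻¹) * |w|⁻¹ ≤ K) (hKc : (K : ℝ) * c < 1)
    (hgp : g p = 0) (hhp : h p = 0) (hgq : g q = 0) (hhq : h q = 0) (hqp : ‖q - p‖ ≤ ρ) :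
    q = p := by
  have h1 := approximatesLinearOn_prodMk hg hh H q (by simpa [dist_eq_norm] using hqp) p
    (by simpa using hρ)
  set A := ((x • ContinuousLinearMap.fst ℝ ℝ ℝ + (0 : ℝ) • ContinuousLinearMap.snd ℝ ℝ ℝ).prod
        (z • ContinuousLinearMap.fst ℝ ℝ ℝ + w • ContinuousLinearMap.snd ℝ ℝ ℝ)) with hA
  simp only [hgp, hhp, hgq, hhq, sub_self, zero_sub, norm_neg] at h1
  have h2 := (lowerTriangularRightInverse x z w hx hw hK1 hK2).bound (A (q - p))
  have h3 : lowerTriangularRightInverse x z w hx hw hK1 hK2 (A (q - p)) = q - p := by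
    change (_, _) = _
    rw [hA]
    ext
    · simp
      field_simp
    · simp
      field_simp
      ring
  rw [h3] at h2
  change ‖q - p‖ ≤ K * _ at h2
  have h4 : ‖q - p‖ ≤ K * (c * ‖q - p‖) := h2.trans (by gcongr)
  have h5 : ‖q - p‖ = 0 := by
    by_contra hne
    have h6 : 0 < ‖q - p‖ := lt_of_le_of_ne (norm_nonneg _) (Ne.symm hne)
    nlinarith
  exact sub_eq_zero.1 (norm_eq_zero.1 h5)

theorem BiBound.weaken_biD₁ {b : ℕ → ℕ → ℝ} {M r : ℝ} (h : BiBound b M r) (hr : 0 < r)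
    (hr1 : r ≤ 1) : BiBound (_root_.biD₁ b) (2 * M / r ^ 2) (r / 4) := by
  have hM := h.nonneg
  refine (h.biD₁ hr).mono ?_ (by positivity) (by linarith)
  rw [div_le_div_iff₀ hr (by positivity)]
  nlinarith [mul_nonneg hM hr.le, mul_nonneg (mul_nonneg hM hr.le) (sub_nonneg.2 hr1)]

theorem BiBound.weaken_biD₂ {b : ℕ → ℕ → ℝ} {M r : ℝ} (h : BiBound b M r) (hr : 0 < r)
    (hr1 : r ≤ 1) : BiBound (_root_.biD₂ b) (2 * M / r ^ 2) (r / 4) := by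
  have hM := h.nonneg
  refine (h.biD₂ hr).mono ?_ (by positivity) (by linarith)
  rw [div_le_div_iff₀ hr (by positivity)]
  nlinarith [mul_nonneg hM hr.le, mul_nonneg (mul_nonneg hM hr.le) (sub_nonneg.2 hr1)]

theorem BiBound.weaken {b : ℕ → ℕ → ℝ} {M r : ℝ} (h : BiBound b M r) (hr : 0 < r)
    (hr1 : r ≤ 1) : BiBound b (2 * M / r ^ 2) (r / 4) := by
  have hM := h.nonneg
  refine h.mono ?_ (by positivity) (by linarith)
  rw [le_div_iff₀ (by positivity)]
  nlinarith [mul_nonneg hM hr.le, mul_nonneg (mul_nonneg hM hr.le) (sub_nonneg.2 hr1),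
    mul_nonneg hM (sub_nonneg.2 hr1)]

theorem BiBound.biD₁_biD₂
    {b : ℕ → ℕ → ℝ} {M r : ℝ} (h : BiBound b M r) (hr : 0 < r) :
    BiBound (_root_.biD₁ (_root_.biD₂ b)) (2 * M / r ^ 2) (r / 4) := by
  refine ((h.biD₂ hr).biD₁ (half_pos hr)).mono (le_of_eq ?_) (by positivity) (by linarith)
  field_simp

theorem BiBound.biD₂_biD₂
    {b : ℕ → ℕ → ℝ} {M r : ℝ} (h : BiBound b M r) (hr : 0 < r) :
    BiBound (_root_.biD₂ (_root_.biD₂ b)) (2 * M / r ^ 2) (r / 4) := by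
  refine ((h.biD₂ hr).biD₂ (half_pos hr)).mono (le_of_eq ?_) (by positivity) (by linarith)
  field_simp

theorem BiBound.abs_biEval_sub_le_of_weaken {b : ℕ → ℕ → ℝ} {M r : ℝ} {n : ℕ} (hr : 0 < r)
    (h : BiBound b (2 * M / r ^ 2) (r / 4)) (hb : BiSupp b n) {p q : ℝ × ℝ} (hp : ‖p‖ ≤ r / 16)
    (hq : ‖q‖ ≤ r / 16) :
    |biEval b n p - biEval b n q| ≤ 64 * M / r ^ 3 * ‖p - q‖ := by
  refine (h.abs_biEval_sub_le (by positivity) hb (by linarith) (by linarith)).trans (le_of_eq ?_)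
  field_simp
  ring

theorem BiBound.abs_biEval_le_of_weaken {b : ℕ → ℕ → ℝ} {M r : ℝ} (n : ℕ) (hr : 0 < r)
    (hr1 : r ≤ 1) (h : BiBound b (2 * M / r ^ 2) (r / 4)) {p : ℝ × ℝ} (hp : ‖p‖ ≤ r / 8) :
    |biEval b n p| ≤ 64 * M / r ^ 3 := by
  have h0 : 0 ≤ M := by
    have := h.nonneg
    rw [le_div_iff₀ (by positivity)] at this
    linarith
  refine (h.abs_biEval_le (by positivity) n (by linarith)).trans ?_
  rw [← mul_div_assoc, div_le_div_iff₀ (by positivity) (by positivity)]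
  have : 0 ≤ M * r ^ 2 := by positivity
  nlinarith

/-- Coefficients of the truncation keeping both exponents at most `L`. -/
def biTrunc (b : ℕ → ℕ → ℝ) (L : ℕ) : ℕ → ℕ → ℝ := fun j k => if j ≤ L ∧ k ≤ L then b j k else 0

theorem BiBound.sub_biTrunc {b : ℕ → ℕ → ℝ} {M r : ℝ} (hr : 0 < r) (h : BiBound b M r) (L : ℕ) :
    BiBound (b - biTrunc b L) (M / 2 ^ L) (r / 2) := by
  intro j k
  have hM := h.nonneg
  by_cases hjk : j ≤ L ∧ k ≤ L
  · simp only [biTrunc, hjk, Pi.sub_apply, and_self, if_true, sub_self, abs_zero]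
    positivity
  · simp only [biTrunc, hjk, Pi.sub_apply, if_false, sub_zero]
    refine (h j k).trans ?_
    rw [div_pow, div_div_eq_mul_div, div_mul_eq_mul_div]
    gcongr
    rw [le_div_iff₀ (by positivity)]
    have : (2 : ℝ) ^ L ≤ 2 ^ (j + k) := pow_le_pow_right₀ (by norm_num) (by omega)
    gcongr

theorem BiSupp.biTrunc {b : ℕ → ℕ → ℝ} {n : ℕ} (h : BiSupp b n) (L : ℕ) :
    BiSupp (biTrunc b L) n := by
  intro j k hjk
  simp [_root_.biTrunc, h j k hjk]

set_option maxHeartbeats 1600000 in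
theorem card_critical_zeros_le {b : ℕ → ℕ → ℝ} {n L : ℕ} {M r s ε : ℝ} (hb : BiSupp b n)
    (hM : BiBound b M r) (hM1 : 1 ≤ M) (hr : 0 < r) (hr1 : r ≤ 1) (hε : 0 < ε) (hε1 : ε ≤ 1)
    (hs : s ≤ r / 32)
    (hnd : ∀ p, ‖p‖ ≤ s → biEval b n p = 0 → biEval (biD₂ b) n p = 0 →
      ε ≤ |biEval (biD₁ b) n p| ∧ ε ≤ |biEval (biD₂ (biD₂ b)) n p|)
    (hL : 512 * (64 * M / r ^ 3) ^ 4 / ε ^ 4 ≤ 2 ^ L) (S : Finset (ℝ × ℝ))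
    (hS : ∀ p ∈ S, ‖p‖ ≤ s ∧ biEval b n p = 0 ∧ biEval (biD₂ b) n p = 0) :
    S.card ≤ (2 * L) * (2 * L) := by
  classical
  rcases S.eq_empty_or_nonempty with rfl | ⟨p₀, hp₀⟩
  · simp
  set B := 64 * M / r ^ 3 with hB
  have hr3 : r ^ 3 ≤ 1 := pow_le_one₀ hr.le hr1
  have hBr : 64 ≤ B * r := by
    rw [hB, div_mul_eq_mul_div, le_div_iff₀ (by positivity)]
    have h2 : r ^ 3 ≤ r := by
      calc r ^ 3 ≤ r ^ 1 := pow_le_pow_of_le_one hr.le hr1 (by norm_num)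
        _ = r := pow_one r
    nlinarith
  have hB1 : 64 ≤ B := hBr.trans (by nlinarith [show 0 ≤ B by positivity])
  have hB0 : 0 < B := by linarith
  set δ := B / 2 ^ L with hδ
  have hδ0 : 0 < δ := by positivity
  have hδ1 : 512 * B ^ 3 * δ ≤ ε ^ 4 := by
    rw [div_le_iff₀ (by positivity)] at hL
    rw [hδ, ← mul_div_assoc, div_le_iff₀ (by positivity)]
    nlinarith
  have hε4 : ε ^ 4 ≤ ε ^ 2 := pow_le_pow_of_le_one hε.le hε1 (by norm_num)
  have hε2 : ε ^ 2 ≤ ε := by nlinarith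
  have hδ2 : 32 * B * δ ≤ ε ^ 2 := by
    have : 32 * B * δ ≤ 512 * B ^ 3 * δ := by
      have : 1 ≤ B ^ 2 := by nlinarith
      have : B * 1 ≤ B * B ^ 2 := by gcongr
      have : B * δ ≤ B ^ 3 * δ := by
        gcongr
        nlinarith
      nlinarith [mul_pos hB0 hδ0]
    linarith
  set t := biTrunc b L with ht
  set e := b - t with he
  have hbe : b = t + e := by rw [he]; abel
  have hts : BiSupp t n := hb.biTrunc L
  have hes : BiSupp e n := fun j k hjk => by simp [he, hb j k hjk, hts j k hjk]
  have heB := hM.sub_biTrunc hr L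
  rw [← ht, ← he] at heB
  have heδ : ∀ c : ℕ → ℕ → ℝ, BiBound c (2 * (M / 2 ^ L) / (r / 2) ^ 2) (r / 2 / 4) →
      ∀ p, ‖p‖ ≤ r / 16 → |biEval c n p| ≤ δ := by
    intro c hc p hp
    refine (hc.abs_biEval_le (by positivity) n (by linarith)).trans ?_
    rw [hδ, le_div_iff₀ (by positivity), hB]
    have : 4 * (2 * (M / 2 ^ L) / (r / 2) ^ 2) * 2 ^ L = 32 * M / r ^ 2 := by
      field_simp
      norm_num
    rw [this, div_le_div_iff₀ (by positivity) (by positivity)]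
    have : 0 ≤ M * r ^ 2 := by positivity
    nlinarith
  have hr2 : r / 2 ≤ 1 := by linarith
  have e0 := heδ _ (heB.weaken (by positivity) hr2)
  have e1 := heδ _ (heB.weaken_biD₁ (by positivity) hr2)
  have e2 := heδ _ (heB.weaken_biD₂ (by positivity) hr2)
  have e12 := heδ _ (heB.biD₁_biD₂ (by positivity))
  have e22 := heδ _ (heB.biD₂_biD₂ (by positivity))
  have l1 := fun p q => (hM.weaken_biD₁ hr hr1).abs_biEval_sub_le_of_weaken (p := p) (q := q) hr
    hb.biD₁
  have l2 := fun p q => (hM.weaken_biD₂ hr hr1).abs_biEval_sub_le_of_weaken (p := p) (q := q) hr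
    hb.biD₂
  have l12 := fun p q => (hM.biD₁_biD₂ hr).abs_biEval_sub_le_of_weaken (p := p) (q := q) hr
    hb.biD₂.biD₁
  have l22 := fun p q => (hM.biD₂_biD₂ hr).abs_biEval_sub_le_of_weaken (p := p) (q := q) hr
    hb.biD₂.biD₂
  rw [← hB] at l1 l2 l12 l22
  have s0 : ∀ p, biEval b n p = biEval t n p + biEval e n p := fun p => by
    rw [← biEval_add, ← hbe]
  have s1 : ∀ p, biEval (biD₁ b) n p = biEval (biD₁ t) n p + biEval (biD₁ e) n p := fun p => by
    rw [← biEval_add, ← biD₁_add, ← hbe]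
  have s2 : ∀ p, biEval (biD₂ b) n p = biEval (biD₂ t) n p + biEval (biD₂ e) n p := fun p => by
    rw [← biEval_add, ← biD₂_add, ← hbe]
  have s12 : ∀ p, biEval (biD₁ (biD₂ b)) n p =
      biEval (biD₁ (biD₂ t)) n p + biEval (biD₁ (biD₂ e)) n p := fun p => by
    rw [← biEval_add, ← biD₁_add, ← biD₂_add, ← hbe]
  have s22 : ∀ p, biEval (biD₂ (biD₂ b)) n p =
      biEval (biD₂ (biD₂ t)) n p + biEval (biD₂ (biD₂ e)) n p := fun p => by
    rw [← biEval_add, ← biD₂_add, ← biD₂_add, ← hbe]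
  -- the derivative of the truncation does not vanish identically
  have hTv : biPoly (biD₂ t) n ≠ 0 := by
    intro h0
    have h1 : ∀ p, biEval (biD₂ t) n p = 0 := fun p => by rw [← eval_biPoly, h0, map_zero]
    have h2 : biEval (biD₂ (biD₂ t)) n p₀ = 0 := by
      have h3 := (hasStrictFDerivAt_biEval hts.biD₂ p₀).hasFDerivAt
      rw [show biEval (biD₂ t) n = fun _ => 0 from funext h1] at h3
      have h4 := h3.unique (hasFDerivAt_const 0 p₀)
      simpa using DFunLike.congr_fun h4 ((0, 1) : ℝ × ℝ)
    obtain ⟨h5, h6, h7⟩ := hS p₀ hp₀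
    have h8 := (hnd p₀ h5 h6 h7).2
    have h9 := e22 p₀ (by linarith)
    rw [s22, h2, zero_add] at h8
    nlinarith
  obtain ⟨ε', hε'1, hε'2⟩ : ∃ c ∈ Set.Ioo 0 δ,
      IsRelPrime (biPoly t n - MvPolynomial.C c) (biPoly (biD₂ t) n) := by
    by_contra! hcon
    exact (Set.Ioo_infinite hδ0).mono (fun c hc => hcon c hc)
      (finite_setOf_not_isRelPrime_sub_C _ hTv)
  set ρ := ε ^ 2 / (64 * B ^ 2) with hρ
  have hρ0 : 0 < ρ := by positivity
  have hBρ : 64 * B ^ 2 * ρ = ε ^ 2 := by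
    rw [hρ]
    field_simp
  have hρr : 2 * ρ ≤ r / 32 := by
    have h1 : ε ^ 2 ≤ 1 := by nlinarith
    have h2 : 64 * (64 * B) * ρ ≤ 1 := by nlinarith [mul_pos hB0 hρ0]
    have h3 : 64 * B * ρ * 64 ≤ (B * r) := by nlinarith
    have h4 : B * (4096 * ρ) ≤ B * r := by linarith
    have h5 := le_of_mul_le_mul_left h4 hB0
    linarith
  obtain ⟨K, hKv⟩ : ∃ K : NNReal, (K : ℝ) = 2 * B / ε ^ 2 := ⟨⟨_, by positivity⟩, rfl⟩
  obtain ⟨c, hcv⟩ : ∃ c : NNReal, (c : ℝ) = ε ^ 2 / (4 * B) := ⟨⟨_, by positivity⟩, rfl⟩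
  have hKc : (K : ℝ)⁻¹ = ε ^ 2 / (2 * B) := by
    rw [hKv, inv_div]
  have hc2 : δ + B * (2 * ρ) ≤ c / 2 := by
    rw [hcv, div_div, le_div_iff₀ (by positivity)]
    nlinarith
  have hball : ∀ p ∈ S, ∀ q, ‖q - p‖ ≤ 2 * ρ → ‖q‖ ≤ r / 16 := by
    intro p hp q hq
    have h1 := (hS p hp).1
    have h2 : ‖q‖ ≤ ‖q - p‖ + ‖p‖ := by simpa using norm_add_le (q - p) p
    linarith
  have hinv : ∀ p ∈ S, |biEval (biD₁ b) n p|⁻¹ ≤ K ∧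
      (1 + |biEval (biD₁ (biD₂ b)) n p| * |biEval (biD₁ b) n p|⁻¹) *
        |biEval (biD₂ (biD₂ b)) n p|⁻¹ ≤ K := by
    intro p hp
    obtain ⟨h5, h6, h7⟩ := hS p hp
    obtain ⟨h8, h9⟩ := hnd p h5 h6 h7
    have h10 : |biEval (biD₁ (biD₂ b)) n p| ≤ B :=
      (hM.biD₁_biD₂ hr).abs_biEval_le_of_weaken n hr hr1 (by linarith)
    have h11 : |biEval (biD₁ b) n p|⁻¹ ≤ ε⁻¹ := inv_anti₀ hε h8
    have h12 : |biEval (biD₂ (biD₂ b)) n p|⁻¹ ≤ ε⁻¹ := inv_anti₀ hε h9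
    have h13 : 1 ≤ ε⁻¹ := (one_le_inv₀ hε).2 hε1
    have hK' : (K : ℝ) = 2 * B * ε⁻¹ * ε⁻¹ := by
      rw [hKv]
      field_simp
    rw [hK']
    constructor
    · nlinarith [mul_nonneg (sub_nonneg.2 h13) (sub_nonneg.2 hB1)]
    · calc _ ≤ (1 + B * ε⁻¹) * ε⁻¹ := by gcongr
        _ ≤ _ := by
          gcongr
          nlinarith
  have hlow : 2 * δ ≤ ((K : ℝ)⁻¹ - c) * ρ := by
    have h1 : (ε ^ 2 / (2 * B) - ε ^ 2 / (4 * B)) * ρ = ε ^ 4 / (256 * B ^ 3) := by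
      rw [hρ]
      field_simp
      norm_num
    rw [hKc, hcv, h1, le_div_iff₀ (by positivity)]
    linarith
  -- for each critical zero there is a zero of the truncated system nearby
  have hmain : ∀ p ∈ S, ∃ z, ‖z - p‖ ≤ ρ ∧ biEval t n z - ε' = 0 ∧ biEval (biD₂ t) n z = 0 := by
    intro p hp
    obtain ⟨h5, h6, h7⟩ := hS p hp
    obtain ⟨h8, h9⟩ := hnd p h5 h6 h7
    have h10 : ‖p‖ ≤ r / 16 := by linarith
    refine exists_zero_near (c := c) (K := K) (fun q => (hasStrictFDerivAt_biEval hts q).sub_const ε')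
      (hasStrictFDerivAt_biEval hts.biD₂) hρ0.le (fun q hq => ?_) (x := biEval (biD₁ b) n p)
      (by rw [← abs_pos]; linarith) (by rw [← abs_pos]; linarith) (hinv p hp).1 (hinv p hp).2 ?_ ?_
    · have hq' := hball p hp q (by linarith)
      have key : ∀ a a' e₁ : ℝ, |a - a'| ≤ B * ‖q - p‖ → |e₁| ≤ δ →
          |(a - e₁) - a'| ≤ c / 2 := by
        intro a a' e₁ h1 h2
        have h3 : B * ‖q - p‖ ≤ B * (2 * ρ) := by gcongr; linarith
        rw [abs_le] at h1 h2 ⊢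
        constructor <;> linarith
      refine ⟨?_, ?_, ?_, ?_⟩
      · rw [eq_sub_of_add_eq (s1 q).symm]
        exact key _ _ _ (l1 q p hq' h10) (e1 q hq')
      · rw [eq_sub_of_add_eq (s2 q).symm, ← h7]
        exact key _ _ _ (l2 q p hq' h10) (e2 q hq')
      · rw [eq_sub_of_add_eq (s12 q).symm]
        exact key _ _ _ (l12 q p hq' h10) (e12 q hq')
      · rw [eq_sub_of_add_eq (s22 q).symm]
        exact key _ _ _ (l22 q p hq' h10) (e22 q hq')
    · have h1 := e0 p h10
      have h3 := s0 p
      rw [h6] at h3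
      refine le_trans ?_ hlow
      rw [abs_le] at h1 ⊢
      constructor <;> linarith [hε'1.1, hε'1.2]
    · have h1 := e2 p h10
      have h3 := s2 p
      rw [h7] at h3
      refine le_trans ?_ hlow
      rw [abs_le] at h1 ⊢
      constructor <;> linarith [hε'1.1, hε'1.2]
  have hinj : ∀ p ∈ S, ∀ q ∈ S, ‖q - p‖ ≤ 2 * ρ → q = p := by
    intro p hp q hq hqp
    obtain ⟨h5, h6, h7⟩ := hS p hp
    obtain ⟨h8, h9⟩ := hnd p h5 h6 h7
    have h10 : ‖p‖ ≤ r / 16 := by linarith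
    refine eq_of_zero_near (c := c) (K := K) (hasStrictFDerivAt_biEval hb)
      (hasStrictFDerivAt_biEval hb.biD₂) (by positivity) (fun q hq => ?_)
      (x := biEval (biD₁ b) n p)
      (by rw [← abs_pos]; linarith) (by rw [← abs_pos]; linarith) (hinv p hp).1 (hinv p hp).2 ?_
      h6 h7 (hS q hq).2.1 (hS q hq).2.2 hqp
    · have hq' := hball p hp q (by linarith)
      have key : ∀ a a' : ℝ, |a - a'| ≤ B * ‖q - p‖ → |a - a'| ≤ c / 2 := by
        intro a a' h1
        have h3 : B * ‖q - p‖ ≤ B * (2 * ρ) := by gcongr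
        linarith
      refine ⟨key _ _ (l1 q p hq' h10), ?_, key _ _ (l12 q p hq' h10),
        key _ _ (l22 q p hq' h10)⟩
      rw [← h7]
      exact key _ _ (l2 q p hq' h10)
    · rw [hKv, hcv]
      have : 2 * B / ε ^ 2 * (ε ^ 2 / (4 * B)) = 1 / 2 := by
        field_simp
        norm_num
      rw [this]
      norm_num
  choose! z hz1 hz2 hz3 using hmain
  have hzinj : Set.InjOn (fun p => ![(z p).1, (z p).2]) (S : Set (ℝ × ℝ)) := by
    intro p hp q hq hpq
    have h1 : z p = z q := Prod.ext (congrFun hpq 0) (congrFun hpq 1)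
    refine (hinj p hp q hq ?_).symm
    calc ‖q - p‖ = ‖(z p - p) - (z q - q)‖ := by rw [h1]; congr 1; abel
      _ ≤ ‖z p - p‖ + ‖z q - q‖ := norm_sub_le _ _
      _ ≤ 2 * ρ := by linarith [hz1 p hp, hz1 q hq]
  rw [← Finset.card_image_of_injOn hzinj]
  refine (card_le_of_isRelPrime hTv hε'2 _ ?_).trans (Nat.mul_le_mul ?_ ?_)
  · intro x hx
    obtain ⟨p, hp, rfl⟩ := Finset.mem_image.1 hx
    refine ⟨?_, ?_⟩
    · rw [map_sub, eval_biPoly, MvPolynomial.eval_C, hz2 p hp]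
    · rw [eval_biPoly, hz3 p hp]
  · refine (MvPolynomial.totalDegree_sub_C_le _ _).trans (totalDegree_biPoly_le n ?_)
    intro j k hjk
    rw [ht, biTrunc, if_neg (by omega)]
  · refine totalDegree_biPoly_le n ?_
    intro j k hjk
    rw [ht, biD₂, biTrunc, if_neg (by omega), mul_zero]

/-- `(Q, E, F)` is an orthonormal frame of `ℝ³`. -/
structure IsFrame (Q E F : Fin 3 → ℝ) : Prop where
  qq : ∑ i, Q i ^ 2 = 1
  ee : ∑ i, E i ^ 2 = 1
  ff : ∑ i, F i ^ 2 = 1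
  qe : ∑ i, Q i * E i = 0
  qf : ∑ i, Q i * F i = 0
  ef : ∑ i, E i * F i = 0

theorem biEval_smul (t : ℝ) (b : ℕ → ℕ → ℝ) (n : ℕ) (p : ℝ × ℝ) :
    biEval (t • b) n p = t * biEval b n p := by
  simp [biEval, mul_assoc, Finset.mul_sum]

theorem biD₁_smul (t : ℝ) (b : ℕ → ℕ → ℝ) : biD₁ (t • b) = t • biD₁ b := by
  ext j k
  simp [biD₁, mul_left_comm]

theorem biD₂_smul (t : ℝ) (b : ℕ → ℕ → ℝ) : biD₂ (t • b) = t • biD₂ b := by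
  ext j k
  simp [biD₂, mul_left_comm]

theorem biEval_biD_of_eq_pow {b : ℕ → ℕ → ℝ} {n : ℕ} (hb : BiSupp b n) {c α β γ : ℝ} {m : ℕ}
    (h : ∀ p : ℝ × ℝ, biEval b n p = c * (α + β * p.1 + γ * p.2) ^ m) (p : ℝ × ℝ) :
    biEval (biD₁ b) n p = (c * m * β) * (α + β * p.1 + γ * p.2) ^ (m - 1) ∧
      biEval (biD₂ b) n p = (c * m * γ) * (α + β * p.1 + γ * p.2) ^ (m - 1) := by
  have h1 := (hasStrictFDerivAt_biEval hb p).hasFDerivAt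
  have h2 : HasFDerivAt (fun p : ℝ × ℝ => c * (α + β * p.1 + γ * p.2) ^ m) _ p :=
    (((((hasFDerivAt_fst (𝕜 := ℝ) (p := p)).const_mul β).const_add α).add
      ((hasFDerivAt_snd (𝕜 := ℝ) (p := p)).const_mul γ)).pow m).const_mul c
  rw [show biEval b n = _ from funext h] at h1
  have h3 := h1.unique h2
  have h4 := DFunLike.congr_fun h3 ((1, 0) : ℝ × ℝ)
  have h5 := DFunLike.congr_fun h3 ((0, 1) : ℝ × ℝ)
  simp at h4 h5
  rw [h4, h5]
  constructor <;> ring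

/-- The linear functional `a ↦ biEval (D (chartCoeff a)) n p` for a linear operator `D`. -/
noncomputable def chartFunctional (d : ℕ) (Q E F : Fin 3 → ℝ) (n : ℕ)
    (D : (ℕ → ℕ → ℝ) → ℕ → ℕ → ℝ) (hadd : ∀ b c, D (b + c) = D b + D c)
    (hsmul : ∀ (t : ℝ) b, D (t • b) = t • D b) (p : ℝ × ℝ) : (degIndex d → ℝ) →ₗ[ℝ] ℝ where
  toFun a := biEval (D (chartCoeff d Q E F a)) n p
  map_add' a a' := by rw [chartCoeff_add, hadd, biEval_add]
  map_smul' t a := by rw [chartCoeff_smul, hsmul, biEval_smul]; rfl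

/-- Point of the frame used to build test directions at the chart point `p`. -/
noncomputable def testPoint (d : ℕ) (Q E F : Fin 3 → ℝ) (p : ℝ × ℝ) (σ η : ℝ) : Fin 3 → ℝ :=
  fun i => (1 - (σ * p.1 + η * p.2) / d) * Q i + σ / d * E i + η / d * F i

section testPoint

variable {d : ℕ} {Q E F : Fin 3 → ℝ}

theorem sum_testPoint_sq_le (hF : IsFrame Q E F) (hd : 1 ≤ d) {p : ℝ × ℝ} (hp : ‖p‖ ≤ 1) {σ η : ℝ}
    (hσ : |σ| + |η| ≤ 1) :
    ∑ i, testPoint d Q E F p σ η i ^ 2 ≤ Real.exp (2 / d) := by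
  have hd' : (0 : ℝ) < d := by positivity
  have h1 : |p.1| ≤ 1 := (norm_fst_le p).trans hp
  have h2 : |p.2| ≤ 1 := (norm_snd_le p).trans hp
  have e : ∑ i, testPoint d Q E F p σ η i ^ 2 =
      (1 - (σ * p.1 + η * p.2) / d) ^ 2 + (σ / d) ^ 2 + (η / d) ^ 2 := by
    have e1 : ∀ i, testPoint d Q E F p σ η i ^ 2 =
        (1 - (σ * p.1 + η * p.2) / d) ^ 2 * Q i ^ 2 + (σ / d) ^ 2 * E i ^ 2 +
        (η / d) ^ 2 * F i ^ 2 + 2 * (1 - (σ * p.1 + η * p.2) / d) * (σ / d) * (Q i * E i) +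
        2 * (1 - (σ * p.1 + η * p.2) / d) * (η / d) * (Q i * F i) +
        2 * (σ / d) * (η / d) * (E i * F i) := fun i => by
      rw [testPoint]
      ring
    simp_rw [e1, Finset.sum_add_distrib, ← Finset.mul_sum, hF.qq, hF.ee, hF.ff, hF.qe, hF.qf,
      hF.ef]
    ring
  have h3 : |(σ * p.1 + η * p.2) / d| ≤ 1 / d := by
    rw [abs_div, abs_of_pos hd']
    gcongr
    calc |σ * p.1 + η * p.2| ≤ |σ| * |p.1| + |η| * |p.2| := by
          rw [← abs_mul, ← abs_mul]; exact abs_add_le _ _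
      _ ≤ |σ| * 1 + |η| * 1 := by gcongr
      _ ≤ 1 := by linarith
  have h4 : (σ / d) ^ 2 + (η / d) ^ 2 ≤ (1 / d) ^ 2 := by
    rw [div_pow, div_pow, div_pow, ← add_div]
    gcongr
    rw [← sq_abs σ, ← sq_abs η]
    nlinarith [abs_nonneg σ, abs_nonneg η]
  have h5 := Real.quadratic_le_exp_of_nonneg (x := 2 / d) (by positivity)
  rw [e]
  refine le_trans ?_ h5
  have h6 : (1 - (σ * p.1 + η * p.2) / d) ^ 2 ≤ (1 + 1 / d) ^ 2 := by
    rw [abs_le] at h3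
    have : (1 : ℝ) / d ≤ 1 := by
      rw [div_le_one hd']
      exact_mod_cast hd
    apply sq_le_sq' <;> linarith
  have : (2 : ℝ) / d = 2 * (1 / d) := by ring
  rw [this]
  nlinarith

/-- Normalized test direction. -/
noncomputable def testDir (d : ℕ) (Q E F : Fin 3 → ℝ) (p : ℝ × ℝ) (σ η : ℝ) : degIndex d → ℝ :=
  (((d + 1) * (d + 2) / 2 * Real.exp 1)⁻¹ : ℝ) • kostlanKernel d (testPoint d Q E F p σ η)

theorem sum_testDir_sq_le (hF : IsFrame Q E F) (hd : 1 ≤ d) {p : ℝ × ℝ} (hp : ‖p‖ ≤ 1) {σ η : ℝ}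
    (hσ : |σ| + |η| ≤ 1) : ∑ i, testDir d Q E F p σ η i ^ 2 ≤ 1 := by
  have hd' : (0 : ℝ) < d := by positivity
  simp only [testDir, Pi.smul_apply, smul_eq_mul, mul_pow]
  rw [← Finset.mul_sum, sum_kostlanKernel_sq, inv_pow, inv_mul_le_iff₀ (by positivity), mul_one,
    mul_pow]
  have h1 : (∑ i, testPoint d Q E F p σ η i ^ 2) ^ d ≤ Real.exp 1 ^ 2 := by
    calc _ ≤ (Real.exp (2 / d)) ^ d := by
          gcongr
          exact sum_testPoint_sq_le hF hd hp hσ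
      _ = Real.exp 1 ^ 2 := by
          rw [← Real.exp_nat_mul, ← Real.exp_nat_mul]
          congr 1
          field_simp
          simp
  have h2 : (1 : ℝ) ≤ (d + 1) * (d + 2) / 2 := by nlinarith
  gcongr
  nlinarith

theorem biEval_chartCoeff_testDir (hF : IsFrame Q E F) (hd : 2 ≤ d) {n : ℕ}
    (hn : ∀ a, BiSupp (chartCoeff d Q E F a) n) (p : ℝ × ℝ) (σ η : ℝ) :
    biEval (chartCoeff d Q E F (testDir d Q E F p σ η)) n p = Real.exp (-1) ∧
    biEval (biD₁ (chartCoeff d Q E F (testDir d Q E F p σ η))) n p = Real.exp (-1) * σ ∧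
    biEval (biD₂ (chartCoeff d Q E F (testDir d Q E F p σ η))) n p = Real.exp (-1) * η ∧
    biEval (biD₂ (biD₂ (chartCoeff d Q E F (testDir d Q E F p σ η)))) n p =
      Real.exp (-1) * ((d - 1) / d * η ^ 2) := by
  have hd' : (0 : ℝ) < d := by positivity
  set b := chartCoeff d Q E F (testDir d Q E F p σ η) with hb
  set α := 1 - (σ * p.1 + η * p.2) / d with hα
  have h0 : ∀ q : ℝ × ℝ, biEval b n q =
      Real.exp (-1) * (α + σ / d * q.1 + η / d * q.2) ^ d := by
    intro q
    rw [hb, testDir, chartCoeff_smul, biEval_smul, biEval_chartCoeff (hn _),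
      kostlanForm_kostlanKernel]
    have e : ∑ i, (Q i + E i * q.1 + F i * q.2) * testPoint d Q E F p σ η i =
        α + σ / d * q.1 + η / d * q.2 := by
      have e1 : ∀ i, (Q i + E i * q.1 + F i * q.2) * testPoint d Q E F p σ η i =
          α * Q i ^ 2 + σ / d * q.1 * E i ^ 2 + η / d * q.2 * F i ^ 2 +
          (σ / d + q.1 * α) * (Q i * E i) + (η / d + q.2 * α) * (Q i * F i) +
          (q.1 * (η / d) + q.2 * (σ / d)) * (E i * F i) := fun i => by
        rw [testPoint, ← hα]
        ring
      simp_rw [e1, Finset.sum_add_distrib, ← Finset.mul_sum, hF.qq, hF.ee, hF.ff, hF.qe, hF.qf,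
        hF.ef]
      ring
    rw [e, Real.exp_neg]
    field_simp
  have hone : α + σ / d * p.1 + η / d * p.2 = 1 := by
    rw [hα]
    ring
  have h1 := biEval_biD_of_eq_pow (hn _) h0
  have h2 := biEval_biD_of_eq_pow (hn _).biD₂ fun q => (h1 q).2
  refine ⟨?_, ?_, ?_, ?_⟩
  · rw [h0, hone, one_pow, mul_one]
  · rw [(h1 p).1, hone, one_pow]
    field_simp
  · rw [(h1 p).2, hone, one_pow]
    field_simp
  · rw [(h2 p).2, hone, one_pow, Nat.cast_sub (by omega)]
    field_simp
    simp

end testPoint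

theorem gaussianMeasure_chart_small_le {d : ℕ} {Q E F : Fin 3 → ℝ} (hF : IsFrame Q E F)
    (hd : 2 ≤ d) {n : ℕ} (hn : ∀ a, BiSupp (chartCoeff d Q E F a) n) {R ε : ℝ} (hR : 1 ≤ R)
    (hε : 0 ≤ ε) {p : ℝ × ℝ} (hp : ‖p‖ ≤ 1) :
    gaussianMeasure (degIndex d) {a | ∑ i, a i ^ 2 ≤ R ^ 2 ∧
      |biEval (chartCoeff d Q E F a) n p| ≤ ε ∧ |biEval (biD₂ (chartCoeff d Q E F a)) n p| ≤ ε ∧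
      (|biEval (biD₁ (chartCoeff d Q E F a)) n p| ≤ ε ∨
        |biEval (biD₂ (biD₂ (chartCoeff d Q E F a))) n p| ≤ ε)} ≤
      ENNReal.ofReal (2 * (Real.exp 6 * (3 * R) ^ 3 * (2 * ε) ^ 3)) := by
  set f₀ := chartFunctional d Q E F n id (fun _ _ => rfl) (fun _ _ => rfl) p with hf₀
  set f₁ := chartFunctional d Q E F n biD₁ biD₁_add biD₁_smul p with hf₁
  set f₂ := chartFunctional d Q E F n biD₂ biD₂_add biD₂_smul p with hf₂
  set f₃ := chartFunctional d Q E F n (fun b => biD₂ (biD₂ b))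
    (fun b c => by rw [biD₂_add, biD₂_add]) (fun t b => by rw [biD₂_smul, biD₂_smul]) p with hf₃
  have hf := biEval_chartCoeff_testDir hF hd hn p
  have e₀ : ∀ σ η, f₀ (testDir d Q E F p σ η) = Real.exp (-1) := fun σ η => (hf σ η).1
  have e₁ : ∀ σ η, f₁ (testDir d Q E F p σ η) = Real.exp (-1) * σ := fun σ η => (hf σ η).2.1
  have e₂ : ∀ σ η, f₂ (testDir d Q E F p σ η) = Real.exp (-1) * η := fun σ η => (hf σ η).2.2.1
  have e₃ : ∀ σ η, f₃ (testDir d Q E F p σ η) = Real.exp (-1) * ((d - 1) / d * η ^ 2) :=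
    fun σ η => (hf σ η).2.2.2
  have hw : ∀ σ η : ℝ, |σ| + |η| ≤ 1 → ∑ i, testDir d Q E F p σ η i ^ 2 ≤ 1 :=
    fun σ η h => sum_testDir_sq_le hF (by omega) hp h
  have hexp : Real.exp (-1) * Real.exp (-1) * Real.exp (-1) = Real.exp (-3) := by
    rw [← Real.exp_add, ← Real.exp_add]
    norm_num
  have hd2 : (1 : ℝ) / 2 ≤ (d - 1) / d := by
    have : (2 : ℝ) ≤ d := by exact_mod_cast hd
    rw [div_le_div_iff₀ (by norm_num) (by linarith)]
    linarith
  have hval : Real.exp 3 * (3 * R) ^ 3 * ((2 * ε) ^ 3 / Real.exp (-3)) =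
      Real.exp 6 * (3 * R) ^ 3 * (2 * ε) ^ 3 := by
    have : Real.exp 6 = Real.exp 3 * Real.exp 3 := by
      rw [← Real.exp_add]
      norm_num
    rw [Real.exp_neg, this]
    field_simp
  have hA := gaussianMeasure_three_small_le ![f₀, f₁, f₂]
    ![testDir d Q E F p 0 0, testDir d Q E F p 1 0, testDir d Q E F p 0 1]
    (fun j => by fin_cases j <;> exact hw _ _ (by norm_num)) hR hε (Real.exp_pos (-3)) (by
      rw [Matrix.det_fin_three]
      simp [e₀, e₁, e₂]
      rw [← hexp])
  have hB := gaussianMeasure_three_small_le ![f₀, f₂, f₃]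
    ![testDir d Q E F p 0 0, testDir d Q E F p 0 1, testDir d Q E F p 0 (-1)]
    (fun j => by fin_cases j <;> exact hw _ _ (by norm_num)) hR hε (Real.exp_pos (-3)) (by
      rw [Matrix.det_fin_three]
      simp [e₀, e₂, e₃]
      refine le_trans ?_ (le_abs_self _)
      have h3 := Real.exp_pos (-3)
      have : Real.exp (-1) * Real.exp (-1) * (Real.exp (-1) * ((d - 1) / d)) +
          Real.exp (-1) * (Real.exp (-1) * ((d - 1) / d)) * Real.exp (-1) =
          Real.exp (-3) * (2 * ((d - 1) / d)) := by
        rw [← hexp]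
        ring
      nlinarith)
  rw [hval] at hA hB
  refine (measure_mono ?_).trans ((measure_union_le {a | _} {a | _}).trans
    ((add_le_add hA hB).trans ?_))
  · rintro a ⟨h1, h2, h3, h4 | h4⟩
    · refine Or.inl ⟨h1, fun i => ?_⟩
      fin_cases i
      exacts [h2, h4, h3]
    · refine Or.inr ⟨h1, fun i => ?_⟩
      fin_cases i
      exacts [h2, h3, h4]
  · rw [← ENNReal.ofReal_add (by positivity) (by positivity), ← two_mul]

theorem exists_net_point {m : ℕ} (hm : 0 < m) {p : ℝ × ℝ} (hp : ‖p‖ ≤ 1) :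
    ∃ z ∈ Finset.Icc (-m : ℤ) m ×ˢ Finset.Icc (-m : ℤ) m,
      ‖p - ((z.1 / m : ℝ), (z.2 / m : ℝ))‖ ≤ 1 / m := by
  have hm' : (0 : ℝ) < m := by exact_mod_cast hm
  have key : ∀ t : ℝ, |t| ≤ 1 → ∃ z ∈ Finset.Icc (-m : ℤ) m, |t - z / m| ≤ 1 / m := by
    intro t ht
    rw [abs_le] at ht
    refine ⟨⌊t * m⌋, Finset.mem_Icc.2 ⟨Int.le_floor.2 ?_, ?_⟩, ?_⟩
    · push_cast
      nlinarith
    · refine Int.floor_le_iff.2 ?_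
      push_cast
      nlinarith
    · have h1 := Int.floor_le (t * m)
      have h2 := Int.lt_floor_add_one (t * m)
      rw [show t - (⌊t * m⌋ : ℝ) / m = (t * m - ⌊t * m⌋) / m by field_simp, abs_div,
        abs_of_pos hm']
      gcongr
      rw [abs_le]
      constructor <;> linarith
  obtain ⟨i, hi, h1⟩ := key p.1 ((norm_fst_le p).trans hp)
  obtain ⟨j, hj, h2⟩ := key p.2 ((norm_snd_le p).trans hp)
  exact ⟨(i, j), Finset.mem_product.2 ⟨hi, hj⟩, max_le h1 h2⟩

theorem gaussianMeasure_degenerate_le {d : ℕ} {Q E F : Fin 3 → ℝ} (hF : IsFrame Q E F)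
    (hd : 2 ≤ d) {n : ℕ} (hn : ∀ a, BiSupp (chartCoeff d Q E F a) n) {R M r s ε : ℝ} (hR : 1 ≤ R)
    (hr : 0 < r) (hr1 : r ≤ 1) (hs : s ≤ r / 32) (hε : 0 < ε) (hε1 : ε ≤ 1)
    (hM : M = R * (d + 2) * Real.exp (d * r ^ 2)) :
    gaussianMeasure (degIndex d) {a | ∑ i, a i ^ 2 ≤ R ^ 2 ∧ ∃ p : ℝ × ℝ, ‖p‖ ≤ s ∧
      biEval (chartCoeff d Q E F a) n p = 0 ∧ biEval (biD₂ (chartCoeff d Q E F a)) n p = 0 ∧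
      (|biEval (biD₁ (chartCoeff d Q E F a)) n p| ≤ ε ∨
        |biEval (biD₂ (biD₂ (chartCoeff d Q E F a))) n p| ≤ ε)} ≤
      ENNReal.ofReal (43200 * Real.exp 6 * (64 * M / r ^ 3) ^ 2 * R ^ 3 * ε) := by
  have hM1 : 1 ≤ M := by
    have h1 : 1 ≤ Real.exp (d * r ^ 2) := Real.one_le_exp (by positivity)
    have h2 : 1 ≤ R * (d + 2) := by nlinarith [Nat.cast_nonneg (α := ℝ) d]
    rw [hM]
    nlinarith
  set B := 64 * M / r ^ 3 with hB
  have hr3 : r ^ 3 ≤ r := by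
    have := pow_le_pow_of_le_one hr.le hr1 (show 1 ≤ 3 by norm_num)
    simpa using this
  have hBr : 64 / r ≤ B := by
    rw [hB]
    gcongr
    linarith
  have hB64 : 64 ≤ B := by
    refine le_trans ?_ hBr
    rw [le_div_iff₀ hr]
    nlinarith
  set m := ⌈B / ε⌉₊ with hm
  have hBε : 64 ≤ B / ε := by
    rw [le_div_iff₀ hε]
    nlinarith
  have hmB : B / ε ≤ m := Nat.le_ceil _
  have hm' : (0 : ℝ) < m := by linarith
  have hm1 : 0 < m := by exact_mod_cast hm'
  have hmB2 : (m : ℝ) ≤ B / ε + 1 := (Nat.ceil_lt_add_one (by linarith)).le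
  have hminv : B * (1 / m) ≤ ε := by
    rw [mul_one_div, div_le_iff₀ hm']
    rw [div_le_iff₀ hε] at hmB
    linarith
  have hminv2 : 1 / (m : ℝ) ≤ r / 32 := by
    rw [div_le_div_iff₀ hm' (by norm_num)]
    rw [div_le_iff₀ hr] at hBr
    have : B ≤ B / ε := by
      rw [le_div_iff₀ hε]
      nlinarith
    nlinarith
  set T := Finset.Icc (-m : ℤ) m ×ˢ Finset.Icc (-m : ℤ) m with hT
  let q : ℤ × ℤ → ℝ × ℝ := fun z => ((z.1 / m : ℝ), (z.2 / m : ℝ))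
  let W : ℝ × ℝ → Set (degIndex d → ℝ) := fun p => {a | ∑ i, a i ^ 2 ≤ R ^ 2 ∧
      |biEval (chartCoeff d Q E F a) n p| ≤ 2 * ε ∧
      |biEval (biD₂ (chartCoeff d Q E F a)) n p| ≤ 2 * ε ∧
      (|biEval (biD₁ (chartCoeff d Q E F a)) n p| ≤ 2 * ε ∨
        |biEval (biD₂ (biD₂ (chartCoeff d Q E F a))) n p| ≤ 2 * ε)}
  have hq : ∀ z ∈ T, ‖q z‖ ≤ 1 := by
    have key : ∀ z ∈ Finset.Icc (-m : ℤ) m, |(z : ℝ) / m| ≤ 1 := by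
      intro z hz
      rw [abs_div, abs_of_pos hm', div_le_one hm', abs_le]
      rw [Finset.mem_Icc] at hz
      exact ⟨by exact_mod_cast hz.1, by exact_mod_cast hz.2⟩
    intro z hz
    rw [hT, Finset.mem_product] at hz
    exact max_le (key _ hz.1) (key _ hz.2)
  refine (measure_mono (t := ⋃ z ∈ T, W (q z)) ?_).trans
    ((measure_biUnion_finset_le T _).trans ((Finset.sum_le_sum fun z hz =>
      gaussianMeasure_chart_small_le hF hd hn hR (by positivity) (hq z hz)).trans ?_))
  · rintro a ⟨ha, p, hp, h0, h2, h3⟩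
    have hb := biBound_chartCoeff hF.qq hF.ee hF.ff hF.qe hF.qf hF.ef (hn a) (by linarith) ha hr
    rw [← hM] at hb
    obtain ⟨z, hz, hpz⟩ := exists_net_point hm1 (p := p) (by linarith)
    have hpr : ‖p‖ ≤ r / 16 := by linarith
    have hqr : ‖q z‖ ≤ r / 16 := by
      have := norm_sub_norm_le (q z) p
      rw [norm_sub_rev] at this
      have h5 : ‖p - q z‖ ≤ 1 / m := hpz
      linarith
    have hlip : ∀ b : ℕ → ℕ → ℝ, BiBound b (2 * M / r ^ 2) (r / 4) → BiSupp b n →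
        |biEval b n (q z)| ≤ |biEval b n p| + ε := by
      intro b h1 h4
      have h5 := h1.abs_biEval_sub_le_of_weaken hr h4 hqr hpr
      have h6 : ‖q z - p‖ ≤ 1 / m := by
        rw [norm_sub_rev]
        exact hpz
      have h7 := abs_sub_abs_le_abs_sub (biEval b n (q z)) (biEval b n p)
      have h8 : B * ‖q z - p‖ ≤ ε := le_trans (by gcongr) hminv
      linarith
    have e0 := hlip _ (hb.weaken hr hr1) (hn a)
    have e1 := hlip _ (hb.weaken_biD₁ hr hr1) (hn a).biD₁
    have e2 := hlip _ (hb.weaken_biD₂ hr hr1) (hn a).biD₂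
    have e3 := hlip _ (hb.biD₂_biD₂ hr) (hn a).biD₂.biD₂
    rw [h0, abs_zero] at e0
    rw [h2, abs_zero] at e2
    refine Set.mem_iUnion₂.2 ⟨z, hz, ha, by linarith, by linarith, ?_⟩
    exact h3.imp (fun h => by linarith) (fun h => by linarith)
  · rw [Finset.sum_const, nsmul_eq_mul, ← ENNReal.ofReal_natCast,
      ← ENNReal.ofReal_mul (by positivity)]
    apply ENNReal.ofReal_le_ofReal
    have hcard : (T.card : ℝ) ≤ (5 * (B / ε)) ^ 2 / 2 := by
      have e : T.card = (2 * m + 1) ^ 2 := by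
        rw [hT, Finset.card_product, Int.card_Icc, sq]
        congr 1 <;> omega
      rw [e]
      push_cast
      have h5 : (2 * m + 1 : ℝ) ≤ 2 * (B / ε) + 3 := by linarith
      have h6 : (2 * m + 1 : ℝ) ^ 2 ≤ (2 * (B / ε) + 3) ^ 2 := by gcongr
      nlinarith
    calc (T.card : ℝ) * (2 * (Real.exp 6 * (3 * R) ^ 3 * (2 * (2 * ε)) ^ 3))
        ≤ ((5 * (B / ε)) ^ 2 / 2) * (2 * (Real.exp 6 * (3 * R) ^ 3 * (2 * (2 * ε)) ^ 3)) := by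
          gcongr
      _ = 43200 * Real.exp 6 * B ^ 2 * R ^ 3 * ε := by
          field_simp
          ring

theorem natDegree_kostlanForm_le (d : ℕ) (a : degIndex d → ℝ) (X : Fin 3 → Polynomial ℝ)
    (hX : ∀ i, (X i).natDegree ≤ 1) : (kostlanForm d a X).natDegree ≤ d := by
  refine Polynomial.natDegree_sum_le_of_forall_le _ _ fun p _ => ?_
  refine (Polynomial.natDegree_C_mul_le _ _).trans ?_
  refine Polynomial.natDegree_mul_le.trans ?_
  have h := p.2
  have h1 : ∀ i k, (X i ^ k).natDegree ≤ k := fun i k =>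
    Polynomial.natDegree_pow_le.trans (by nlinarith [hX i])
  have h2 := Polynomial.natDegree_mul_le (p := X 0 ^ (p.1.1 : ℕ)) (q := X 1 ^ (p.1.2 : ℕ))
  have h3 := h1 0 p.1.1
  have h4 := h1 1 p.1.2
  have h5 := h1 2 (d - (p.1.1 : ℕ) - (p.1.2 : ℕ))
  omega

/-- A Kostlan form which does not vanish identically on an affine line has at most `d` zeros
there. -/
theorem card_zeros_line_le {d : ℕ} (a : degIndex d → ℝ) (c e : Fin 3 → ℝ) (t₀ : ℝ)
    (h₀ : kostlanForm d a (fun i => c i + e i * t₀) ≠ 0) (T : Finset ℝ)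
    (hT : ∀ t ∈ T, kostlanForm d a (fun i => c i + e i * t) = 0) : T.card ≤ d := by
  set G := kostlanForm d a (fun i => Polynomial.C (c i) + Polynomial.C (e i) * Polynomial.X)
    with hG
  have heval : ∀ t, G.eval t = kostlanForm d a (fun i => c i + e i * t) := fun t => by
    rw [hG, ← Polynomial.coe_aeval_eq_eval, kostlanForm_map]
    simp
  have hG0 : G ≠ 0 := by
    rintro h
    rw [← heval, h, Polynomial.eval_zero] at h₀
    exact h₀ rfl
  have hsub : T ⊆ G.roots.toFinset := fun t ht => by
    rw [Multiset.mem_toFinset, Polynomial.mem_roots hG0, Polynomial.IsRoot, heval, hT t ht]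
  calc T.card ≤ G.roots.toFinset.card := Finset.card_le_card hsub
    _ ≤ G.roots.card := Multiset.toFinset_card_le _
    _ ≤ G.natDegree := Polynomial.card_roots' _
    _ ≤ d := by
      refine natDegree_kostlanForm_le d a _ fun i => ?_
      compute_degree

theorem finite_zeros_line {d : ℕ} (a : degIndex d → ℝ) (c e : Fin 3 → ℝ) (t₀ : ℝ)
    (h₀ : kostlanForm d a (fun i => c i + e i * t₀) ≠ 0) :
    {t | kostlanForm d a (fun i => c i + e i * t) = 0}.Finite := by
  by_contra h
  obtain ⟨T, hT, hcard⟩ := Set.Infinite.exists_subset_card_eq h (d + 1)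
  have := card_zeros_line_le a c e t₀ h₀ T fun t ht => hT ht
  omega

/-- Zeros of a function on the boundary of a square, when each side carries at most `d` zeros. -/
theorem card_zeros_square_le {d : ℕ} {s : ℝ} {f : ℝ × ℝ → ℝ}
    (h₁ : ∀ c, |c| = s → ∀ T : Finset ℝ, (∀ t ∈ T, f (c, t) = 0) → T.card ≤ d)
    (h₂ : ∀ c, |c| = s → ∀ T : Finset ℝ, (∀ t ∈ T, f (t, c) = 0) → T.card ≤ d)
    (S : Finset (ℝ × ℝ)) (hS : ∀ p ∈ S, ‖p‖ = s ∧ f p = 0) : S.card ≤ 4 * d := by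
  classical
  have k₁ : ∀ c, |c| = s → (S.filter (fun p => p.1 = c)).card ≤ d := by
    intro c hc
    rw [← Finset.card_image_of_injOn (f := Prod.snd)]
    · refine h₁ c hc _ fun t ht => ?_
      obtain ⟨p, hp, rfl⟩ := Finset.mem_image.1 ht
      rw [Finset.mem_filter] at hp
      rw [← hp.2]
      exact (hS p hp.1).2
    · intro p hp q hq h
      simp only [Finset.coe_filter, Set.mem_ofPred_eq] at hp hq
      exact Prod.ext (hp.2.trans hq.2.symm) h
  have k₂ : ∀ c, |c| = s → (S.filter (fun p => p.2 = c)).card ≤ d := by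
    intro c hc
    rw [← Finset.card_image_of_injOn (f := Prod.fst)]
    · refine h₂ c hc _ fun t ht => ?_
      obtain ⟨p, hp, rfl⟩ := Finset.mem_image.1 ht
      rw [Finset.mem_filter] at hp
      rw [← hp.2]
      exact (hS p hp.1).2
    · intro p hp q hq h
      simp only [Finset.coe_filter, Set.mem_ofPred_eq] at hp hq
      exact Prod.ext h (hp.2.trans hq.2.symm)
  rcases lt_or_ge s 0 with hs | hs
  · have : S = ∅ := Finset.eq_empty_of_forall_notMem fun p hp => by
      have := (hS p hp).1
      have := norm_nonneg p
      linarith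
    simp [this]
  have hs1 : |s| = s := abs_of_nonneg hs
  have hs2 : |-s| = s := by rw [abs_neg, hs1]
  have hsub : S ⊆ ((S.filter (fun p => p.1 = s)) ∪ (S.filter (fun p => p.1 = -s))) ∪
      ((S.filter (fun p => p.2 = s)) ∪ (S.filter (fun p => p.2 = -s))) := by
    intro p hp
    have h : max |p.1| |p.2| = s := (hS p hp).1
    simp only [Finset.mem_union, Finset.mem_filter, hp, true_and]
    rcases max_choice |p.1| |p.2| with h' | h'
    · exact Or.inl ((abs_eq hs).1 (h'.symm.trans h))
    · exact Or.inr ((abs_eq hs).1 (h'.symm.trans h))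
  have h1 := k₁ s hs1
  have h2 := k₁ (-s) hs2
  have h3 := k₂ s hs1
  have h4 := k₂ (-s) hs2
  have h5 := Finset.card_le_card hsub
  have h6 := Finset.card_union_le ((S.filter (fun p => p.1 = s)) ∪ (S.filter (fun p => p.1 = -s)))
    ((S.filter (fun p => p.2 = s)) ∪ (S.filter (fun p => p.2 = -s)))
  have h7 := Finset.card_union_le (S.filter (fun p => p.1 = s)) (S.filter (fun p => p.1 = -s))
  have h8 := Finset.card_union_le (S.filter (fun p => p.2 = s)) (S.filter (fun p => p.2 = -s))
  omega

/-- A zero with nonzero partial derivative in the second variable lies on an arc of zeros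
moving to the right. -/
theorem exists_arc_of_hasStrictFDerivAt {f : ℝ × ℝ → ℝ} {p : ℝ × ℝ} {c e : ℝ}
    (hf : HasStrictFDerivAt f
      (c • ContinuousLinearMap.fst ℝ ℝ ℝ + e • ContinuousLinearMap.snd ℝ ℝ ℝ) p)
    (he : e ≠ 0) (hp : f p = 0) {O : Set (ℝ × ℝ)} (hO : O ∈ nhds p) :
    ∃ C ⊆ O, IsPreconnected C ∧ p ∈ C ∧ (∀ q ∈ C, f q = 0) ∧ ∃ q ∈ C, p.1 < q.1 := by
  let A : (ℝ × ℝ) ≃L[ℝ] ℝ × ℝ := ContinuousLinearEquiv.equivOfInverse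
    ((ContinuousLinearMap.fst ℝ ℝ ℝ).prod
      (c • ContinuousLinearMap.fst ℝ ℝ ℝ + e • ContinuousLinearMap.snd ℝ ℝ ℝ))
    ((ContinuousLinearMap.fst ℝ ℝ ℝ).prod
      ((-(c / e)) • ContinuousLinearMap.fst ℝ ℝ ℝ + e⁻¹ • ContinuousLinearMap.snd ℝ ℝ ℝ))
    (fun x => by ext <;> simp; field_simp; ring) (fun x => by ext <;> simp; field_simp; ring)
  have hG : HasStrictFDerivAt (fun q : ℝ × ℝ => (q.1, f q)) (A : (ℝ × ℝ) →L[ℝ] ℝ × ℝ) p :=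
    hasStrictFDerivAt_fst.prodMk hf
  set Φ := hG.toOpenPartialHomeomorph _ with hΦ
  have hcoe : ∀ q, Φ q = (q.1, f q) := fun q => rfl
  have hps : p ∈ Φ.source := hG.mem_toOpenPartialHomeomorph_source
  have hΦp : Φ p = (p.1, 0) := by rw [hcoe, hp]
  have hpt : (p.1, (0 : ℝ)) ∈ Φ.target := hΦp ▸ Φ.map_source hps
  have hsymm : Φ.symm (p.1, 0) = p := by rw [← hΦp, Φ.left_inv hps]
  have hN : Φ.target ∩ Φ.symm ⁻¹' O ∈ nhds (p.1, (0 : ℝ)) := by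
    refine Filter.inter_mem (Φ.open_target.mem_nhds hpt) ?_
    refine (Φ.continuousAt_symm hpt).preimage_mem_nhds ?_
    rwa [hsymm]
  have hN' : (fun t : ℝ => (t, (0 : ℝ))) ⁻¹' (Φ.target ∩ Φ.symm ⁻¹' O) ∈ nhds p.1 :=
    (by fun_prop : Continuous fun t : ℝ => (t, (0 : ℝ))).continuousAt.preimage_mem_nhds hN
  obtain ⟨δ, hδ, hball⟩ := Metric.nhds_basis_closedBall.mem_iff.1 hN'
  rw [Real.closedBall_eq_Icc] at hball
  have hI : ∀ t ∈ Set.Icc p.1 (p.1 + δ), (t, (0 : ℝ)) ∈ Φ.target ∩ Φ.symm ⁻¹' O :=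
    fun t ht => hball ⟨by linarith [ht.1], ht.2⟩
  have hr : ∀ t ∈ Set.Icc p.1 (p.1 + δ), ((Φ.symm (t, 0)).1, f (Φ.symm (t, 0))) = (t, 0) :=
    fun t ht => by rw [← hcoe, Φ.right_inv (hI t ht).1]
  refine ⟨(fun t => Φ.symm (t, 0)) '' Set.Icc p.1 (p.1 + δ), ?_, ?_, ?_, ?_, ?_⟩
  · rintro _ ⟨t, ht, rfl⟩
    exact (hI t ht).2
  · refine isPreconnected_Icc.image _ (Φ.continuousOn_symm.comp (by fun_prop) ?_)
    exact fun t ht => (hI t ht).1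
  · exact ⟨p.1, ⟨le_rfl, by linarith⟩, hsymm⟩
  · rintro _ ⟨t, ht, rfl⟩
    exact (Prod.ext_iff.1 (hr t ht)).2
  · refine ⟨_, ⟨p.1 + δ, ⟨by linarith, le_rfl⟩, rfl⟩, ?_⟩
    have := (Prod.ext_iff.1 (hr (p.1 + δ) ⟨by linarith, le_rfl⟩)).1
    simp only at this
    linarith

/-- Coordinate of the point `(x : y : 1)` of the projective plane along `V`. -/
def homCoord (V : Fin 3 → ℝ) (q : ℝ × ℝ) : ℝ := V 0 * q.1 + V 1 * q.2 + V 2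

theorem continuous_homCoord (V : Fin 3 → ℝ) : Continuous (homCoord V) := by
  unfold homCoord
  fun_prop

/-- Affine chart of the projective plane attached to a frame. -/
noncomputable def frameChart (Q E F : Fin 3 → ℝ) (q : ℝ × ℝ) : ℝ × ℝ :=
  (homCoord E q / homCoord Q q, homCoord F q / homCoord Q q)

/-- Inverse of `frameChart`. -/
noncomputable def frameChartInv (Q E F : Fin 3 → ℝ) (p : ℝ × ℝ) : ℝ × ℝ :=
  ((Q 0 + E 0 * p.1 + F 0 * p.2) / (Q 2 + E 2 * p.1 + F 2 * p.2),
    (Q 1 + E 1 * p.1 + F 1 * p.2) / (Q 2 + E 2 * p.1 + F 2 * p.2))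

namespace IsFrame

variable {Q E F : Fin 3 → ℝ}

theorem swap (h : IsFrame Q E F) : IsFrame Q F E :=
  ⟨h.qq, h.ff, h.ee, h.qf, h.qe, by rw [← h.ef]; exact Finset.sum_congr rfl fun i _ => mul_comm _ _⟩

theorem sum_mul_eq (h : IsFrame Q E F) (i j : Fin 3) :
    Q i * Q j + E i * E j + F i * F j = if i = j then 1 else 0 := by
  have h1 : (Matrix.of ![Q, E, F]) * (Matrix.of ![Q, E, F]).transpose = 1 := by
    have hqq := h.qq
    have hee := h.ee
    have hff := h.ff
    have hqe := h.qe
    have hqf := h.qf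
    have hef := h.ef
    simp only [Fin.sum_univ_three] at *
    ext i j
    rw [Matrix.mul_apply, Fin.sum_univ_three]
    fin_cases i <;> fin_cases j <;> simp <;> linarith
  have h2 := congrArg (fun M : Matrix (Fin 3) (Fin 3) ℝ => M i j) (mul_eq_one_comm.1 h1)
  rw [Matrix.mul_apply, Fin.sum_univ_three, Matrix.one_apply] at h2
  simpa using h2

theorem decomp (h : IsFrame Q E F) (q : ℝ × ℝ) (i : Fin 3) :
    (![q.1, q.2, 1] : Fin 3 → ℝ) i =
      homCoord Q q * Q i + homCoord E q * E i + homCoord F q * F i := by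
  have h0 := h.sum_mul_eq 0 i
  have h1 := h.sum_mul_eq 1 i
  have h2 := h.sum_mul_eq 2 i
  have e : homCoord Q q * Q i + homCoord E q * E i + homCoord F q * F i =
      q.1 * (Q 0 * Q i + E 0 * E i + F 0 * F i) + q.2 * (Q 1 * Q i + E 1 * E i + F 1 * F i) +
      (Q 2 * Q i + E 2 * E i + F 2 * F i) := by
    simp only [homCoord]
    ring
  rw [e, h0, h1, h2]
  fin_cases i <;> simp

theorem frame_frameChart (h : IsFrame Q E F) {q : ℝ × ℝ} (hq : homCoord Q q ≠ 0) (i : Fin 3) :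
    (![q.1, q.2, 1] : Fin 3 → ℝ) i =
      homCoord Q q * (Q i + E i * (frameChart Q E F q).1 + F i * (frameChart Q E F q).2) := by
  rw [h.decomp, frameChart]
  field_simp

theorem frameChartInv_frameChart (h : IsFrame Q E F) {q : ℝ × ℝ} (hq : homCoord Q q ≠ 0) :
    Q 2 + E 2 * (frameChart Q E F q).1 + F 2 * (frameChart Q E F q).2 ≠ 0 ∧
      frameChartInv Q E F (frameChart Q E F q) = q := by
  have h0 := h.frame_frameChart hq 0
  have h1 := h.frame_frameChart hq 1
  have h2 := h.frame_frameChart hq 2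
  simp only [Matrix.cons_val] at h0 h1 h2
  have hne : Q 2 + E 2 * (frameChart Q E F q).1 + F 2 * (frameChart Q E F q).2 ≠ 0 := by
    intro h3
    rw [h3, mul_zero] at h2
    exact one_ne_zero h2
  refine ⟨hne, Prod.ext ?_ ?_⟩
  · rw [frameChartInv, div_eq_iff hne]
    refine mul_left_cancel₀ hq ?_
    rw [← h0, mul_left_comm, ← h2, mul_one]
  · rw [frameChartInv, div_eq_iff hne]
    refine mul_left_cancel₀ hq ?_
    rw [← h1, mul_left_comm, ← h2, mul_one]

theorem homCoord_frameChartInv (h : IsFrame Q E F) {p : ℝ × ℝ}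
    (hp : Q 2 + E 2 * p.1 + F 2 * p.2 ≠ 0) :
    homCoord Q (frameChartInv Q E F p) = (Q 2 + E 2 * p.1 + F 2 * p.2)⁻¹ ∧
    homCoord E (frameChartInv Q E F p) = (Q 2 + E 2 * p.1 + F 2 * p.2)⁻¹ * p.1 ∧
    homCoord F (frameChartInv Q E F p) = (Q 2 + E 2 * p.1 + F 2 * p.2)⁻¹ * p.2 := by
  have hqq := h.qq
  have hee := h.ee
  have hff := h.ff
  have hqe := h.qe
  have hqf := h.qf
  have hef := h.ef
  simp only [Fin.sum_univ_three] at hqq hee hff hqe hqf hef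
  have key : ∀ V : Fin 3 → ℝ, homCoord V (frameChartInv Q E F p) =
      (Q 2 + E 2 * p.1 + F 2 * p.2)⁻¹ * (V 0 * (Q 0 + E 0 * p.1 + F 0 * p.2) +
        V 1 * (Q 1 + E 1 * p.1 + F 1 * p.2) + V 2 * (Q 2 + E 2 * p.1 + F 2 * p.2)) := by
    intro V
    simp only [homCoord, frameChartInv]
    generalize Q 2 + E 2 * p.1 + F 2 * p.2 = w at hp ⊢
    field_simp
  refine ⟨?_, ?_, ?_⟩
  · rw [key]
    conv_rhs => rw [← mul_one (Q 2 + E 2 * p.1 + F 2 * p.2)⁻¹]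
    congr 1
    linear_combination hqq + p.1 * hqe + p.2 * hqf
  · rw [key]
    congr 1
    linear_combination hqe + p.1 * hee + p.2 * hef
  · rw [key]
    congr 1
    linear_combination hqf + p.1 * hef + p.2 * hff

theorem frameChart_frameChartInv (h : IsFrame Q E F) {p : ℝ × ℝ}
    (hp : Q 2 + E 2 * p.1 + F 2 * p.2 ≠ 0) : frameChart Q E F (frameChartInv Q E F p) = p := by
  obtain ⟨h1, h2, h3⟩ := h.homCoord_frameChartInv hp
  have := inv_ne_zero hp
  rw [frameChart, h1, h2, h3]
  exact Prod.ext (mul_div_cancel_left₀ _ this) (mul_div_cancel_left₀ _ this)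

theorem injOn_frameChart (h : IsFrame Q E F) :
    Set.InjOn (frameChart Q E F) {q | homCoord Q q ≠ 0} := by
  intro q hq q' hq' e
  rw [← (h.frameChartInv_frameChart hq).2, e, (h.frameChartInv_frameChart hq').2]

theorem kostlanForm_frameChart_eq_zero_iff (h : IsFrame Q E F) {d : ℕ} (a : degIndex d → ℝ)
    {q : ℝ × ℝ} (hq : homCoord Q q ≠ 0) :
    kostlanForm d a (fun i => Q i + E i * (frameChart Q E F q).1 + F i * (frameChart Q E F q).2) = 0
      ↔ kostlanPoly₂ d a q.1 q.2 = 0 := by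
  rw [kostlanPoly₂_eq_kostlanForm, funext (h.frame_frameChart hq), kostlanForm_smul, mul_eq_zero]
  simp [hq]

/-- A component of the zero set lying in a chart cell contains a point where the second partial
derivative of the equation vanishes. -/
theorem exists_critical_point (h : IsFrame Q E F) {d : ℕ} {a : degIndex d → ℝ} {s : ℝ}
    {f f₁ f₂ : ℝ × ℝ → ℝ}
    (hf : ∀ p, f p = kostlanForm d a (fun i => Q i + E i * p.1 + F i * p.2))
    (hf' : ∀ p, HasStrictFDerivAt f
      (f₁ p • ContinuousLinearMap.fst ℝ ℝ ℝ + f₂ p • ContinuousLinearMap.snd ℝ ℝ ℝ) p)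
    {K : Set (ℝ × ℝ)} (hK : IsCompact K) (hne : K.Nonempty)
    (hKZ : ∀ q ∈ K, kostlanPoly₂ d a q.1 q.2 = 0)
    (hmax : ∀ C : Set (ℝ × ℝ), IsPreconnected C → (∀ q ∈ C, kostlanPoly₂ d a q.1 q.2 = 0) →
      (C ∩ K).Nonempty → C ⊆ K)
    (hcell : ∀ q ∈ K, homCoord Q q ≠ 0 ∧ ‖frameChart Q E F q‖ < s) :
    ∃ q ∈ K, f₂ (frameChart Q E F q) = 0 := by
  have hcont : ContinuousOn (fun q => (frameChart Q E F q).1) K :=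
    (continuous_homCoord E).continuousOn.div (continuous_homCoord Q).continuousOn
      fun q hq => (hcell q hq).1
  obtain ⟨q, hq, hqmax⟩ := hK.exists_isMaxOn hne hcont
  refine ⟨q, hq, ?_⟩
  by_contra hne2
  set p := frameChart Q E F q with hp
  obtain ⟨hw, hinv⟩ := h.frameChartInv_frameChart (hcell q hq).1
  rw [← hp] at hw hinv
  have hfp : f p = 0 := by
    rw [hf, hp, h.kostlanForm_frameChart_eq_zero_iff a (hcell q hq).1]
    exact hKZ q hq
  have hO : {p : ℝ × ℝ | Q 2 + E 2 * p.1 + F 2 * p.2 ≠ 0} ∈ nhds p :=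
    IsOpen.mem_nhds (isOpen_ne_fun (by fun_prop) continuous_const) hw
  obtain ⟨C, hCO, hCc, hpC, hC0, p', hp'C, hlt⟩ :=
    exists_arc_of_hasStrictFDerivAt (hf' p) hne2 hfp hO
  have hD : frameChartInv Q E F '' C ⊆ K := by
    refine hmax _ (hCc.image _ ?_) ?_ ⟨q, ⟨p, hpC, hinv⟩, hq⟩
    · refine ContinuousOn.prodMk ?_ ?_
      · exact ContinuousOn.div (by fun_prop) (by fun_prop) hCO
      · exact ContinuousOn.div (by fun_prop) (by fun_prop) hCO
    · rintro _ ⟨p'', hp'', rfl⟩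
      have hw'' := hCO hp''
      rw [← h.kostlanForm_frameChart_eq_zero_iff a, h.frameChart_frameChartInv hw'', ← hf]
      · exact hC0 _ hp''
      · rw [(h.homCoord_frameChartInv hw'').1]
        exact inv_ne_zero hw''
  have h1 := hqmax (hD ⟨p', hp'C, rfl⟩)
  simp only [Set.mem_ofPred_eq] at h1
  rw [h.frameChart_frameChartInv (hCO hp'C)] at h1
  exact absurd h1 (not_le.2 hlt)

end IsFrame

namespace IsFrame

variable {Q E F : Fin 3 → ℝ}

theorem norm_frameChart (q : ℝ × ℝ) :
    ‖frameChart Q E F q‖ = max |homCoord E q| |homCoord F q| / |homCoord Q q| := by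
  rw [Prod.norm_def, frameChart, Real.norm_eq_abs, Real.norm_eq_abs, abs_div, abs_div,
    max_div_div_right (abs_nonneg _)]

theorem norm_frameChart_lt_iff {s : ℝ} (q : ℝ × ℝ) :
    (homCoord Q q ≠ 0 ∧ ‖frameChart Q E F q‖ < s) ↔
      max |homCoord E q| |homCoord F q| < s * |homCoord Q q| := by
  rw [norm_frameChart]
  by_cases h0 : homCoord Q q = 0
  · have : (0 : ℝ) ≤ max |homCoord E q| |homCoord F q| := (abs_nonneg _).trans (le_max_left _ _)
    simp only [h0, ne_eq, not_true_eq_false, false_and, abs_zero, mul_zero, false_iff, not_lt, this]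
  · rw [div_lt_iff₀ (abs_pos.2 h0)]
    simp [h0]

theorem norm_frameChart_eq (h : IsFrame Q E F) {s : ℝ} {q : ℝ × ℝ}
    (hq : max |homCoord E q| |homCoord F q| = s * |homCoord Q q|) :
    homCoord Q q ≠ 0 ∧ ‖frameChart Q E F q‖ = s := by
  have h0 : homCoord Q q ≠ 0 := by
    intro h0
    rw [h0, abs_zero, mul_zero] at hq
    have hE : homCoord E q = 0 := abs_nonpos_iff.1 (hq ▸ le_max_left _ _)
    have hF : homCoord F q = 0 := abs_nonpos_iff.1 (hq ▸ le_max_right _ _)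
    have := h.decomp q 2
    rw [h0, hE, hF] at this
    simp at this
  exact ⟨h0, by rw [norm_frameChart, hq, mul_div_cancel_right₀ _ (abs_pos.2 h0).ne']⟩

end IsFrame

/-- Count of the components of the zero set from counts of special points in chart cells. -/
theorem card_components_le {d : ℕ} {a : degIndex d → ℝ} {κ : Type*} [Fintype κ]
    {Q E F : κ → Fin 3 → ℝ} {s : ℝ} {N : ℕ} (hF : ∀ k, IsFrame (Q k) (E k) (F k))
    (hcov : ∀ q, ∃ k, homCoord (Q k) q ≠ 0 ∧ ‖frameChart (Q k) (E k) (F k) q‖ < s)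
    {f f₁ f₂ : κ → ℝ × ℝ → ℝ}
    (hf : ∀ k p, f k p = kostlanForm d a (fun i => Q k i + E k i * p.1 + F k i * p.2))
    (hf' : ∀ k p, HasStrictFDerivAt (f k)
      (f₁ k p • ContinuousLinearMap.fst ℝ ℝ ℝ + f₂ k p • ContinuousLinearMap.snd ℝ ℝ ℝ) p)
    (hbd : ∀ k, ∀ S : Finset (ℝ × ℝ), (∀ p ∈ S, ‖p‖ = s ∧ f k p = 0) → S.card ≤ 4 * d)
    (hcr : ∀ k, ∀ S : Finset (ℝ × ℝ), (∀ p ∈ S, ‖p‖ ≤ s ∧ f k p = 0 ∧ f₂ k p = 0) → S.card ≤ N)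
    (hbox : ∀ ρ₀ : ℝ, ∃ ρ ≥ ρ₀, ∀ S : Finset (ℝ × ℝ),
      (∀ q ∈ S, ‖q‖ = ρ ∧ kostlanPoly₂ d a q.1 q.2 = 0) → S.card ≤ 4 * d)
    {n : ℕ} (φ : Fin n → ConnectedComponents {q : ℝ × ℝ // kostlanPoly₂ d a q.1 q.2 = 0})
    (hφ : Function.Injective φ) : n ≤ 4 * d + Fintype.card κ * (4 * d + N) := by
  classical
  set Z : Set (ℝ × ℝ) := {q | kostlanPoly₂ d a q.1 q.2 = 0} with hZ
  have hZc : IsClosed Z := isClosed_eq (by unfold kostlanPoly₂; fun_prop) continuous_const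
  choose x hx using fun i => ConnectedComponents.surjective_coe (φ i)
  set K : Fin n → Set (ℝ × ℝ) := fun i => connectedComponentIn Z (x i) with hK
  have hxZ : ∀ i, (x i : ℝ × ℝ) ∈ Z := fun i => (x i).2
  have hxK : ∀ i, (x i : ℝ × ℝ) ∈ K i := fun i => mem_connectedComponentIn (hxZ i)
  have hKZ : ∀ i, K i ⊆ Z := fun i => connectedComponentIn_subset _ _
  have hKc : ∀ i, IsPreconnected (K i) := fun i => isPreconnected_connectedComponentIn
  have hmax : ∀ i, ∀ C : Set (ℝ × ℝ), IsPreconnected C → C ⊆ Z → (C ∩ K i).Nonempty →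
      C ⊆ K i := by
    rintro i C hC hCZ ⟨y, hyC, hyK⟩
    have : K i = connectedComponentIn Z y := connectedComponentIn_eq hyK
    rw [this]
    exact hC.subset_connectedComponentIn hyC hCZ
  have hdisj : ∀ i j q, q ∈ K i → q ∈ K j → i = j := by
    intro i j q hi hj
    have h1 : (x j : ℝ × ℝ) ∈ K i := hmax i (K j) (hKc j) (hKZ j) ⟨q, hj, hi⟩ (hxK j)
    simp only [hK, connectedComponentIn_eq_image (hxZ i)] at h1
    obtain ⟨y, hy, hyx⟩ := h1
    have : y = x j := Subtype.ext hyx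
    rw [this] at hy
    apply hφ
    rw [← hx, ← hx]
    exact (ConnectedComponents.coe_eq_coe'.2 hy).symm
  have hKclosed : ∀ i, IsClosed (K i) := by
    intro i
    refine isClosed_of_closure_subset (hmax i _ (hKc i).closure ?_ ?_)
    · exact closure_minimal (hKZ i) hZc
    · exact ⟨x i, subset_closure (hxK i), hxK i⟩
  have key : ∀ (T : Finset (Fin n)) (g : ℝ × ℝ → ℝ × ℝ) (W : Set (ℝ × ℝ)) (P : ℝ × ℝ → Prop)
      (c : ℕ), Set.InjOn g W → (∀ S : Finset (ℝ × ℝ), (∀ p ∈ S, P p) → S.card ≤ c) →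
      (∀ i ∈ T, ∃ q ∈ K i, q ∈ W ∧ P (g q)) → T.card ≤ c := by
    intro T g W P c hg hP hT
    choose! q hqK hqW hqP using hT
    rw [← Finset.card_image_of_injOn (f := fun i => g (q i)) (s := T)]
    · refine hP _ fun p hp => ?_
      obtain ⟨i, hi, rfl⟩ := Finset.mem_image.1 hp
      exact hqP i hi
    · intro i hi j hj hij
      have : q i = q j := hg (hqW i hi) (hqW j hj) hij
      exact hdisj i j (q i) (hqK i hi) (this ▸ hqK j hj)
  set U : Finset (Fin n) := Finset.univ.filter fun i => ¬ Bornology.IsBounded (K i) with hU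
  set B : κ → Finset (Fin n) := fun k => Finset.univ.filter fun i =>
    ∃ q ∈ K i, homCoord (Q k) q ≠ 0 ∧ ‖frameChart (Q k) (E k) (F k) q‖ = s with hB
  set I : κ → Finset (Fin n) := fun k => Finset.univ.filter fun i => Bornology.IsBounded (K i) ∧
    ∀ q ∈ K i, homCoord (Q k) q ≠ 0 ∧ ‖frameChart (Q k) (E k) (F k) q‖ < s with hI
  have hUcard : U.card ≤ 4 * d := by
    obtain ⟨ρ, hρ, hS⟩ := hbox (∑ i, ‖(x i : ℝ × ℝ)‖)
    refine key U id Set.univ _ _ Function.injective_id.injOn hS fun i hi => ?_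
    have hi' : ¬ Bornology.IsBounded (K i) := (Finset.mem_filter.1 hi).2
    have h1 : ‖(x i : ℝ × ℝ)‖ ≤ ρ := le_trans
      (Finset.single_le_sum (f := fun i => ‖(x i : ℝ × ℝ)‖) (fun _ _ => norm_nonneg _)
        (Finset.mem_univ i)) hρ
    have h2 : ∃ y ∈ K i, ρ ≤ ‖y‖ := by
      by_contra! h
      exact hi' ((Metric.isBounded_closedBall (x := (0 : ℝ × ℝ)) (r := ρ)).subset fun y hy =>
        mem_closedBall_zero_iff.2 (h y hy).le)
    obtain ⟨y, hy, hyρ⟩ := h2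
    obtain ⟨q, hq, hqρ⟩ := (hKc i).intermediate_value (hxK i) hy continuous_norm.continuousOn
      ⟨h1, hyρ⟩
    exact ⟨q, hq, trivial, hqρ, hKZ i hq⟩
  have hBcard : ∀ k, (B k).card ≤ 4 * d := by
    intro k
    refine key (B k) _ _ _ _ (hF k).injOn_frameChart (hbd k) fun i hi => ?_
    obtain ⟨q, hq, h0, hs⟩ := (Finset.mem_filter.1 hi).2
    refine ⟨q, hq, h0, hs, ?_⟩
    rw [hf, (hF k).kostlanForm_frameChart_eq_zero_iff a h0]
    exact hKZ i hq
  have hIcard : ∀ k, (I k).card ≤ N := by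
    intro k
    refine key (I k) _ _ _ _ (hF k).injOn_frameChart (hcr k) fun i hi => ?_
    obtain ⟨hb, hcell⟩ := (Finset.mem_filter.1 hi).2
    obtain ⟨q, hq, hq0⟩ := (hF k).exists_critical_point (hf k) (hf' k)
      (Metric.isCompact_of_isClosed_isBounded (hKclosed i) hb) ⟨x i, hxK i⟩
      (fun q hq => hKZ i hq) (hmax i) hcell
    refine ⟨q, hq, (hcell q hq).1, (hcell q hq).2.le, ?_, hq0⟩
    rw [hf, (hF k).kostlanForm_frameChart_eq_zero_iff a (hcell q hq).1]
    exact hKZ i hq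
  have hsub : (Finset.univ : Finset (Fin n)) ⊆ U ∪ Finset.univ.biUnion fun k => B k ∪ I k := by
    intro i _
    rw [Finset.mem_union, Finset.mem_biUnion]
    by_cases hb : Bornology.IsBounded (K i)
    · obtain ⟨k, hk⟩ := hcov (x i)
      refine Or.inr ⟨k, Finset.mem_univ _, ?_⟩
      rw [Finset.mem_union]
      by_cases hall : ∀ q ∈ K i, homCoord (Q k) q ≠ 0 ∧ ‖frameChart (Q k) (E k) (F k) q‖ < s
      · exact Or.inr (Finset.mem_filter.2 ⟨Finset.mem_univ _, hb, hall⟩)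
      · refine Or.inl (Finset.mem_filter.2 ⟨Finset.mem_univ _, ?_⟩)
        push Not at hall
        obtain ⟨y, hy, hy'⟩ := hall
        have h1 := (IsFrame.norm_frameChart_lt_iff (x i : ℝ × ℝ)).1 hk
        have h2 : ¬ (homCoord (Q k) y ≠ 0 ∧ ‖frameChart (Q k) (E k) (F k) y‖ < s) :=
          fun h => absurd h.2 (not_lt.2 (hy' h.1))
        rw [IsFrame.norm_frameChart_lt_iff, not_lt] at h2
        have hG : Continuous fun q => max |homCoord (E k) q| |homCoord (F k) q| -
            s * |homCoord (Q k) q| :=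
          ((continuous_homCoord _).abs.max (continuous_homCoord _).abs).sub
            (continuous_const.mul (continuous_homCoord _).abs)
        obtain ⟨q, hq, hq0⟩ := (hKc i).intermediate_value (hxK i) hy hG.continuousOn
          (show (0 : ℝ) ∈ _ from ⟨sub_nonpos.2 h1.le, sub_nonneg.2 h2⟩)
        exact ⟨q, hq, (hF k).norm_frameChart_eq (sub_eq_zero.1 hq0)⟩
    · exact Or.inl (Finset.mem_filter.2 ⟨Finset.mem_univ _, hb⟩)
  calc n = (Finset.univ : Finset (Fin n)).card := by simp
    _ ≤ _ := Finset.card_le_card hsub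
    _ ≤ U.card + (Finset.univ.biUnion fun k => B k ∪ I k).card := Finset.card_union_le _ _
    _ ≤ 4 * d + ∑ k : κ, (4 * d + N) := by
      refine add_le_add hUcard (Finset.card_biUnion_le.trans (Finset.sum_le_sum fun k _ => ?_))
      exact (Finset.card_union_le _ _).trans (add_le_add (hBcard k) (hIcard k))
    _ = 4 * d + Fintype.card κ * (4 * d + N) := by simp

theorem exists_square_card_zeros_le {d : ℕ} {a : degIndex d → ℝ} {x₀ y₀ : ℝ}
    (h₀ : kostlanPoly₂ d a x₀ y₀ ≠ 0) (ρ₀ : ℝ) : ∃ ρ ≥ ρ₀, ∀ S : Finset (ℝ × ℝ),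
      (∀ q ∈ S, ‖q‖ = ρ ∧ kostlanPoly₂ d a q.1 q.2 = 0) → S.card ≤ 4 * d := by
  have e₁ : ∀ x y, kostlanPoly₂ d a x y =
      kostlanForm d a (fun i => (![x, 0, 1] : Fin 3 → ℝ) i + (![0, 1, 0] : Fin 3 → ℝ) i * y) := by
    intro x y
    rw [kostlanPoly₂_eq_kostlanForm]
    congr 1
    ext i
    fin_cases i <;> simp
  have e₂ : ∀ x y, kostlanPoly₂ d a x y =
      kostlanForm d a (fun i => (![0, y, 1] : Fin 3 → ℝ) i + (![1, 0, 0] : Fin 3 → ℝ) i * x) := by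
    intro x y
    rw [kostlanPoly₂_eq_kostlanForm]
    congr 1
    ext i
    fin_cases i <;> simp
  have hA : {x | kostlanPoly₂ d a x y₀ = 0}.Finite := by
    simp_rw [e₂] at h₀ ⊢
    exact finite_zeros_line a _ _ x₀ h₀
  have hB : {y | kostlanPoly₂ d a x₀ y = 0}.Finite := by
    simp_rw [e₁] at h₀ ⊢
    exact finite_zeros_line a _ _ y₀ h₀
  have hAB := (hA.union hB).union ((hA.union hB).preimage (f := fun t : ℝ => -t)
    neg_injective.injOn)
  obtain ⟨ρ, hρ, hρ'⟩ := ((Set.Ici_infinite ρ₀).sdiff hAB).nonempty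
  have hne : ∀ c, |c| = ρ → kostlanPoly₂ d a c y₀ ≠ 0 ∧ kostlanPoly₂ d a x₀ c ≠ 0 := by
    intro c hc
    simp only [Set.mem_union, Set.mem_preimage, Set.mem_ofPred_eq, not_or] at hρ'
    rcases abs_choice c with h | h
    · rw [← h, hc]
      exact hρ'.1
    · rw [show c = -ρ by linarith]
      exact hρ'.2
  refine ⟨ρ, hρ, card_zeros_square_le (f := fun q => kostlanPoly₂ d a q.1 q.2) ?_ ?_⟩
  · intro c hc T hT
    have h1 := (hne c hc).1
    simp only [e₁] at h1 hT
    exact card_zeros_line_le a _ _ y₀ h1 T hT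
  · intro c hc T hT
    have h1 := (hne c hc).2
    simp only [e₂] at h1 hT
    exact card_zeros_line_le a _ _ x₀ h1 T hT

/-- Quantitative nondegeneracy of the critical zeros of a polynomial in a square. -/
def CritNondegenerate (b : ℕ → ℕ → ℝ) (n : ℕ) (s ε : ℝ) : Prop :=
  ∀ p : ℝ × ℝ, ‖p‖ ≤ s → biEval b n p = 0 → biEval (biD₂ b) n p = 0 →
    ε ≤ |biEval (biD₁ b) n p| ∧ ε ≤ |biEval (biD₂ (biD₂ b)) n p|

theorem biEval_biD₂_eq_zero_of_line {b : ℕ → ℕ → ℝ} {n : ℕ} (hb : BiSupp b n) {c : ℝ}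
    (h : ∀ t, biEval b n (c, t) = 0) (t : ℝ) : biEval (biD₂ b) n (c, t) = 0 := by
  have h1 := (hasStrictFDerivAt_biEval hb (c, t)).hasFDerivAt.comp_hasDerivAt t
    ((hasDerivAt_const t c).prodMk (hasDerivAt_id t))
  have h2 : (biEval b n ∘ Prod.mk c) = fun _ => 0 := funext h
  rw [h2] at h1
  simpa using h1.unique (hasDerivAt_const t (0 : ℝ))

theorem eventually_biEval_biD₂_eq_zero {b : ℕ → ℕ → ℝ} {n : ℕ} (hb : BiSupp b n) {p : ℝ × ℝ}
    (h : ∀ᶠ q in nhds p, biEval b n q = 0) : ∀ᶠ q in nhds p, biEval (biD₂ b) n q = 0 := by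
  refine h.eventually_nhds.mono fun q hq => ?_
  have h1 := (hasStrictFDerivAt_biEval hb q).hasFDerivAt
  have h2 : HasFDerivAt (biEval b n) (0 : ℝ × ℝ →L[ℝ] ℝ) q :=
    (hasFDerivAt_const (0 : ℝ) q).congr_of_eventuallyEq hq
  simpa using DFunLike.congr_fun (h1.unique h2) (0, 1)

theorem CritNondegenerate.exists_ne_zero {b : ℕ → ℕ → ℝ} {n : ℕ} {s ε : ℝ}
    (h : CritNondegenerate b n s ε) (hε : 0 < ε) (hb : BiSupp b n) {c : ℝ} (hc : |c| ≤ s) :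
    ∃ t, biEval b n (c, t) ≠ 0 := by
  by_contra! h0
  have h1 := biEval_biD₂_eq_zero_of_line hb h0
  have h2 := biEval_biD₂_eq_zero_of_line hb.biD₂ h1
  have h3 := (h (c, 0) (by simpa [Prod.norm_def] using hc)
    (h0 0) (h1 0)).2
  rw [h2, abs_zero] at h3
  linarith

theorem CritNondegenerate.exists_ne_zero_of_mem_nhds {b : ℕ → ℕ → ℝ} {n : ℕ} {s ε : ℝ}
    (h : CritNondegenerate b n s ε) (hε : 0 < ε) (hb : BiSupp b n) {p : ℝ × ℝ} (hp : ‖p‖ ≤ s)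
    {O : Set (ℝ × ℝ)} (hO : O ∈ nhds p) : ∃ q ∈ O, biEval b n q ≠ 0 := by
  by_contra! h0
  have h1 : ∀ᶠ q in nhds p, biEval b n q = 0 := Filter.eventually_of_mem hO h0
  have h2 := eventually_biEval_biD₂_eq_zero hb h1
  have h3 := eventually_biEval_biD₂_eq_zero hb.biD₂ h2
  have h4 := (h p hp h1.self_of_nhds h2.self_of_nhds).2
  rw [h3.self_of_nhds, abs_zero] at h4
  linarith

/-- Deterministic bound on the number of components when the polynomial is nondegenerate in
every chart. -/
theorem card_components_le_of_critNondegenerate {d : ℕ} {a : degIndex d → ℝ} {κ : Type*}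
    [Fintype κ] {Q E F : κ → Fin 3 → ℝ} {R M r s ε : ℝ} {n n' : κ → ℕ} {L : ℕ}
    (hF : ∀ k, IsFrame (Q k) (E k) (F k))
    (hcov : ∀ q, ∃ k, homCoord (Q k) q ≠ 0 ∧ ‖frameChart (Q k) (E k) (F k) q‖ < s)
    (hn : ∀ k, BiSupp (chartCoeff d (Q k) (E k) (F k) a) (n k))
    (hn' : ∀ k, BiSupp (chartCoeff d (Q k) (F k) (E k) a) (n' k))
    (hR : 1 ≤ R) (ha : ∑ i, a i ^ 2 ≤ R ^ 2) (hr : 0 < r) (hr1 : r ≤ 1) (hs : s ≤ r / 32)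
    (hε : 0 < ε) (hε1 : ε ≤ 1) (hM : M = R * (d + 2) * Real.exp (d * r ^ 2))
    (hL : 512 * (64 * M / r ^ 3) ^ 4 / ε ^ 4 ≤ 2 ^ L)
    (hnd : ∀ k, CritNondegenerate (chartCoeff d (Q k) (E k) (F k) a) (n k) s ε)
    (hnd' : ∀ k, CritNondegenerate (chartCoeff d (Q k) (F k) (E k) a) (n' k) s ε)
    {m : ℕ} (φ : Fin m → ConnectedComponents {q : ℝ × ℝ // kostlanPoly₂ d a q.1 q.2 = 0})
    (hφ : Function.Injective φ) : m ≤ 4 * d + Fintype.card κ * (4 * d + 2 * L * (2 * L)) := by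
  have hM1 : 1 ≤ M := by
    have h1 : 1 ≤ Real.exp (d * r ^ 2) := Real.one_le_exp (by positivity)
    have h2 : 1 ≤ R * (d + 2) := by nlinarith [Nat.cast_nonneg (α := ℝ) d]
    rw [hM]
    nlinarith
  refine card_components_le hF hcov
    (f := fun k => biEval (chartCoeff d (Q k) (E k) (F k) a) (n k))
    (fun k p => biEval_chartCoeff (hn k) p)
    (fun k p => hasStrictFDerivAt_biEval (hn k) p) ?_ ?_ ?_ φ hφ
  · intro k
    refine card_zeros_square_le ?_ ?_
    · intro c hc T hT
      obtain ⟨t₀, ht₀⟩ := (hnd k).exists_ne_zero hε (hn k) hc.le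
      simp only [biEval_chartCoeff (hn k)] at hT ht₀
      exact card_zeros_line_le a (fun i => Q k i + E k i * c) (F k) t₀ ht₀ T hT
    · intro c hc T hT
      obtain ⟨t₀, ht₀⟩ := (hnd' k).exists_ne_zero hε (hn' k) hc.le
      rw [biEval_chartCoeff (hn' k)] at ht₀
      simp only [biEval_chartCoeff (hn k)] at hT
      refine card_zeros_line_le a (fun i => Q k i + F k i * c) (E k) t₀ ht₀ T fun t ht => ?_
      rw [← hT t ht]
      congr 1
      ext i
      ring
  · intro k S hS
    have hb := biBound_chartCoeff (hF k).qq (hF k).ee (hF k).ff (hF k).qe (hF k).qf (hF k).ef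
      (hn k) (by linarith) ha hr
    rw [← hM] at hb
    exact card_critical_zeros_le (hn k) hb hM1 hr hr1 hε hε1 hs (hnd k) hL S hS
  · obtain ⟨k, hk0, hks⟩ := hcov 0
    have hw := ((hF k).frameChartInv_frameChart hk0).1
    have hO : {p : ℝ × ℝ | Q k 2 + E k 2 * p.1 + F k 2 * p.2 ≠ 0} ∈
        nhds (frameChart (Q k) (E k) (F k) 0) :=
      IsOpen.mem_nhds (isOpen_ne_fun (by fun_prop) continuous_const) hw
    obtain ⟨p, hp, hp0⟩ := (hnd k).exists_ne_zero_of_mem_nhds hε (hn k) hks.le hO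
    refine exists_square_card_zeros_le (x₀ := (frameChartInv (Q k) (E k) (F k) p).1)
      (y₀ := (frameChartInv (Q k) (E k) (F k) p).2) ?_
    rw [ne_eq, ← (hF k).kostlanForm_frameChart_eq_zero_iff a, (hF k).frameChart_frameChartInv hp,
      ← biEval_chartCoeff (hn k)]
    · exact hp0
    · rw [((hF k).homCoord_frameChartInv hp).1]
      exact inv_ne_zero hp

theorem exists_isFrame_of_unit {Q : Fin 3 → ℝ} (hQ : ∑ i, Q i ^ 2 = 1) :
    ∃ E F, IsFrame Q E F := by
  rw [Fin.sum_univ_three] at hQ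
  by_cases h : Q 0 ^ 2 + Q 1 ^ 2 = 0
  · have h0 : Q 0 = 0 := by nlinarith [sq_nonneg (Q 0), sq_nonneg (Q 1)]
    have h1 : Q 1 = 0 := by nlinarith [sq_nonneg (Q 0), sq_nonneg (Q 1)]
    refine ⟨![1, 0, 0], ![0, 1, 0], ?_, ?_, ?_, ?_, ?_, ?_⟩ <;>
      simp [Fin.sum_univ_three, h0, h1]
    simpa [h0, h1] using hQ
  · have hpos : 0 < Q 0 ^ 2 + Q 1 ^ 2 := lt_of_le_of_ne (by positivity) (Ne.symm h)
    set ρ := Real.sqrt (Q 0 ^ 2 + Q 1 ^ 2) with hρ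
    have hρ0 : 0 < ρ := Real.sqrt_pos.2 hpos
    have hρ2 : ρ ^ 2 = Q 0 ^ 2 + Q 1 ^ 2 := Real.sq_sqrt hpos.le
    refine ⟨![-Q 1 / ρ, Q 0 / ρ, 0], ![-Q 0 * Q 2 / ρ, -Q 1 * Q 2 / ρ, ρ], ?_, ?_, ?_, ?_, ?_, ?_⟩
    · rw [Fin.sum_univ_three, hQ]
    · simp [Fin.sum_univ_three]
      field_simp
      linarith
    · simp [Fin.sum_univ_three]
      field_simp
      linear_combination (ρ ^ 2 - Q 2 ^ 2) * hρ2 + ρ ^ 2 * hQ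
    · simp [Fin.sum_univ_three]
      field_simp
      ring
    · simp [Fin.sum_univ_three]
      field_simp
      linear_combination Q 2 * hρ2
    · simp [Fin.sum_univ_three]
      field_simp
      ring

theorem exists_isFrame_direction (v : Fin 3 → ℝ) :
    ∃ Q E F t, IsFrame Q E F ∧ 0 ≤ t ∧ ∀ i, v i = t * Q i := by
  by_cases hv : ∑ i, v i ^ 2 = 0
  · obtain ⟨E, F, h⟩ := exists_isFrame_of_unit (Q := ![1, 0, 0]) (by simp [Fin.sum_univ_three])
    refine ⟨_, E, F, 0, h, le_rfl, fun i => ?_⟩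
    rw [Finset.sum_eq_zero_iff_of_nonneg fun i _ => sq_nonneg (v i)] at hv
    simpa using hv i (Finset.mem_univ i)
  · have hpos : 0 < ∑ i, v i ^ 2 :=
      lt_of_le_of_ne (Finset.sum_nonneg fun i _ => sq_nonneg _) (Ne.symm hv)
    set t := Real.sqrt (∑ i, v i ^ 2) with ht
    have ht0 : 0 < t := Real.sqrt_pos.2 hpos
    have ht2 : t ^ 2 = ∑ i, v i ^ 2 := Real.sq_sqrt hpos.le
    obtain ⟨E, F, h⟩ := exists_isFrame_of_unit (Q := fun i => v i / t) (by
      simp_rw [div_pow]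
      rw [← Finset.sum_div, ← ht2, div_self (by positivity)])
    exact ⟨_, E, F, t, h, ht0.le, fun i => by field_simp⟩

theorem abs_sum_mul_le_two {V w : Fin 3 → ℝ} (hV : ∑ i, V i ^ 2 = 1) (hw : ∀ i, |w i| ≤ 1) :
    |∑ i, V i * w i| ≤ 2 := by
  have h1 := Finset.sum_mul_sq_le_sq_mul_sq Finset.univ V w
  have h2 : ∑ i, w i ^ 2 ≤ ∑ _i : Fin 3, (1 : ℝ) :=
    Finset.sum_le_sum fun i _ => (sq_le_one_iff_abs_le_one _).2 (hw i)
  rw [hV, one_mul] at h1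
  simp only [Finset.sum_const, Finset.card_univ, Fintype.card_fin, nsmul_eq_mul] at h2
  refine abs_le_of_sq_le_sq (by norm_num at h2; linarith) (by norm_num)

/-- A family of at most `C / s ^ 3` frames whose cells of size `s` cover the affine plane. -/
theorem exists_frame_cover {s : ℝ} (hs : 0 < s) (hs1 : s ≤ 1) :
    ∃ n : ℕ, ((2 * n + 1 : ℕ) : ℝ) ≤ 15 / s ∧ ∃ Q E F : (Fin 3 → Fin (2 * n + 1)) → Fin 3 → ℝ,
      (∀ k, IsFrame (Q k) (E k) (F k)) ∧
      ∀ q, ∃ k, homCoord (Q k) q ≠ 0 ∧ ‖frameChart (Q k) (E k) (F k) q‖ < s := by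
  set n := ⌈6 / s⌉₊ with hn
  have hn1 : 6 / s ≤ n := Nat.le_ceil _
  have hn2 : (n : ℝ) < 6 / s + 1 := Nat.ceil_lt_add_one (by positivity)
  have hs6 : 1 ≤ 1 / s := by rwa [le_div_iff₀ hs, one_mul]
  have h6 : 6 / s = 6 * (1 / s) := by ring
  have hn0 : (0 : ℝ) < n := lt_of_lt_of_le (by positivity) hn1
  have hsn : 2 < s * (n - 3) := by
    rw [div_le_iff₀ hs] at hn1
    nlinarith
  have hn3 : (3 : ℝ) < n := by
    by_contra! h
    nlinarith
  choose Q E F t hF ht hv using fun k : Fin 3 → Fin (2 * n + 1) =>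
    exists_isFrame_direction fun i => ((k i : ℕ) : ℝ) - n
  refine ⟨n, ?_, Q, E, F, hF, fun q => ?_⟩
  · push_cast
    have : 15 / s = 15 * (1 / s) := by ring
    linarith
  set X : Fin 3 → ℝ := ![q.1, q.2, 1] with hX
  set μ := ‖X‖ with hμ
  have hμ0 : 0 < μ := lt_of_lt_of_le one_pos (by simpa [hX] using norm_le_pi_norm X 2)
  have hXμ : ∀ i, |n / μ * X i| ≤ n := by
    intro i
    rw [abs_mul, abs_of_pos (by positivity : 0 < n / μ), div_mul_eq_mul_div, div_le_iff₀ hμ0]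
    gcongr
    exact norm_le_pi_norm X i
  have hfl : ∀ i, ⌊n / μ * X i + n⌋₊ < 2 * n + 1 := by
    intro i
    rw [Nat.lt_succ_iff]
    refine Nat.floor_le_of_le ?_
    push_cast
    linarith [(abs_le.1 (hXμ i)).2]
  set k : Fin 3 → Fin (2 * n + 1) := fun i => ⟨_, hfl i⟩ with hk
  set w : Fin 3 → ℝ := fun i => n / μ * X i - (((k i : ℕ) : ℝ) - n) with hw
  have hw1 : ∀ i, |w i| ≤ 1 := by
    intro i
    have h1 := Nat.floor_le (a := n / μ * X i + n) (by linarith [(abs_le.1 (hXμ i)).1])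
    have h2 := Nat.lt_floor_add_one (n / μ * X i + n)
    simp only [hw, hk]
    rw [abs_le]
    constructor <;> linarith
  have hcoord : ∀ V : Fin 3 → ℝ, n / μ * homCoord V q =
      t k * ∑ i, V i * Q k i + ∑ i, V i * w i := by
    intro V
    rw [Finset.mul_sum, ← Finset.sum_add_distrib]
    have : ∀ i, t k * (V i * Q k i) + V i * w i = n / μ * (V i * X i) := by
      intro i
      simp only [hw, hv]
      ring
    rw [Finset.sum_congr rfl fun i _ => this i, ← Finset.mul_sum, Fin.sum_univ_three]
    simp [homCoord, hX]
  have hE := abs_sum_mul_le_two (hF k).ee hw1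
  have hFk := abs_sum_mul_le_two (hF k).ff hw1
  have hQ := abs_sum_mul_le_two (hF k).qq hw1
  have htk : n - 1 ≤ t k := by
    obtain ⟨i, hi⟩ : ∃ i, |n / μ * X i| = n := by
      obtain ⟨i, hi⟩ : ∃ i, ‖X i‖ = ‖X‖ := by
        by_contra! h
        exact lt_irrefl μ ((pi_norm_lt_iff hμ0).2 fun i => lt_of_le_of_ne (norm_le_pi_norm X i) (h i))
      refine ⟨i, ?_⟩
      rw [abs_mul, abs_of_pos (by positivity : 0 < n / μ), ← Real.norm_eq_abs, hi, ← hμ]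
      field_simp
    have h1 : |t k * Q k i| ≤ t k := by
      rw [abs_mul, abs_of_nonneg (ht k)]
      refine mul_le_of_le_one_right (ht k) ((sq_le_one_iff_abs_le_one _).1 ?_)
      rw [← (hF k).qq]
      exact Finset.single_le_sum (f := fun i => Q k i ^ 2) (fun _ _ => sq_nonneg _)
        (Finset.mem_univ i)
    have h2 : n / μ * X i = t k * Q k i + w i := by
      simp only [hw, ← hv]
      ring
    have h3 := abs_add_le (t k * Q k i) (w i)
    rw [← h2, hi] at h3
    linarith [hw1 i]
  refine ⟨k, (IsFrame.norm_frameChart_lt_iff q).2 ?_⟩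
  have hpos : 0 < n / μ := by positivity
  have habs : ∀ x, n / μ * |x| = |n / μ * x| := fun x => by rw [abs_mul, abs_of_pos hpos]
  have e1 := hcoord (E k)
  have e2 := hcoord (F k)
  have e3 := hcoord (Q k)
  have s1 : ∑ i, E k i * Q k i = 0 := by
    rw [← (hF k).qe]
    exact Finset.sum_congr rfl fun i _ => mul_comm _ _
  have s2 : ∑ i, F k i * Q k i = 0 := by
    rw [← (hF k).qf]
    exact Finset.sum_congr rfl fun i _ => mul_comm _ _
  have s3 : ∑ i, Q k i * Q k i = 1 := by
    rw [← (hF k).qq]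
    exact Finset.sum_congr rfl fun i _ => (sq _).symm
  rw [s1, mul_zero, zero_add] at e1
  rw [s2, mul_zero, zero_add] at e2
  rw [s3, mul_one] at e3
  have a1 : n / μ * |homCoord (E k) q| ≤ 2 := by
    rw [habs, e1]
    exact hE
  have a2 : n / μ * |homCoord (F k) q| ≤ 2 := by
    rw [habs, e2]
    exact hFk
  have a3 : n - 3 ≤ n / μ * |homCoord (Q k) q| := by
    rw [habs, e3]
    refine le_trans ?_ (le_abs_self _)
    linarith [(abs_le.1 hQ).1]
  have a4 : 2 < n / μ * (s * |homCoord (Q k) q|) := by nlinarith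
  refine max_lt ?_ ?_
  · exact lt_of_mul_lt_mul_left (a1.trans_lt a4) hpos.le
  · exact lt_of_mul_lt_mul_left (a2.trans_lt a4) hpos.le

theorem gaussianMeasure_manyComponents_le {d : ℕ} (hd : 2 ≤ d) {κ : Type*} [Fintype κ]
    {Q E F : κ → Fin 3 → ℝ} {R M r s ε B : ℝ} {L : ℕ}
    (hF : ∀ k, IsFrame (Q k) (E k) (F k))
    (hcov : ∀ q, ∃ k, homCoord (Q k) q ≠ 0 ∧ ‖frameChart (Q k) (E k) (F k) q‖ < s)
    (hR : 1 ≤ R) (hr : 0 < r) (hr1 : r ≤ 1) (hs : s ≤ r / 32) (hε : 0 < ε) (hε1 : ε ≤ 1)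
    (hM : M = R * (d + 2) * Real.exp (d * r ^ 2))
    (hL : 512 * (64 * M / r ^ 3) ^ 4 / ε ^ 4 ≤ 2 ^ L)
    (hB : ((4 * d + Fintype.card κ * (4 * d + 2 * L * (2 * L)) : ℕ) : ℝ) < B) :
    gaussianMeasure (degIndex d)
      {a | ∃ n : ℕ, B ≤ n ∧ ∃ φ : Fin n →
        ConnectedComponents {q : ℝ × ℝ // kostlanPoly₂ d a q.1 q.2 = 0}, Function.Injective φ} ≤
      ENNReal.ofReal (2 ^ ((Fintype.card (degIndex d) : ℝ) / 2) * Real.exp (-R ^ 2 / 2)) +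
      ENNReal.ofReal (2 * Fintype.card κ *
        (43200 * Real.exp 6 * (64 * M / r ^ 3) ^ 2 * R ^ 3 * ε)) := by
  choose n hn using fun k => exists_biSupp_chartCoeff d (Q k) (E k) (F k)
  choose n' hn' using fun k => exists_biSupp_chartCoeff d (Q k) (F k) (E k)
  have hdeg := fun k => gaussianMeasure_degenerate_le (hF k) hd (hn k) hR hr hr1 hs hε hε1 hM
  have hdeg' := fun k =>
    gaussianMeasure_degenerate_le (hF k).swap hd (hn' k) hR hr hr1 hs hε hε1 hM
  generalize 43200 * Real.exp 6 * (64 * M / r ^ 3) ^ 2 * R ^ 3 * ε = W at hdeg hdeg' ⊢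
  have hsum : ENNReal.ofReal (2 * Fintype.card κ * W) =
      ∑ _k : κ, ENNReal.ofReal W + ∑ _k : κ, ENNReal.ofReal W := by
    rw [Finset.sum_const, Finset.card_univ, nsmul_eq_mul, ← two_mul, ← mul_assoc,
      ENNReal.ofReal_mul (by positivity), ENNReal.ofReal_mul (by positivity)]
    simp
  refine le_trans (measure_mono ?_) (le_trans (measure_union_le _ _) (add_le_add
    (gaussianMeasure_norm_tail_le (degIndex d) R) (le_trans (measure_union_le _ _)
      (le_trans (add_le_add ((measure_iUnion_fintype_le _ _).trans
        (Finset.sum_le_sum fun k _ => hdeg k)) ((measure_iUnion_fintype_le _ _).trans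
        (Finset.sum_le_sum fun k _ => hdeg' k))) hsum.ge))))
  rintro a ⟨m, hm, φ, hφ⟩
  by_contra hbad
  simp only [Set.mem_union, Set.mem_iUnion, Set.mem_ofPred_eq, not_or, not_exists, not_and,
    not_lt, not_le] at hbad
  obtain ⟨ha, h1, h2⟩ := hbad
  have hle := card_components_le_of_critNondegenerate hF hcov (fun k => hn k a)
    (fun k => hn' k a) hR ha hr hr1 hs hε hε1 hM hL
    (fun k p hp h0 h2' => ⟨(h1 k ha p hp h0 h2').1.le, (h1 k ha p hp h0 h2').2.le⟩)
    (fun k p hp h0 h2' => ⟨(h2 k ha p hp h0 h2').1.le, (h2 k ha p hp h0 h2').2.le⟩) φ hφ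
  exact absurd (hm.trans (Nat.cast_le.2 hle)) (not_le.2 hB)

theorem eventually_mul_pow_le_exp (B : ℝ) (k : ℕ) {c : ℝ} (hc : 0 < c) :
    ∀ᶠ d : ℕ in Filter.atTop, B * (d : ℝ) ^ k ≤ Real.exp (c * d) := by
  have h := (isLittleO_pow_exp_pos_mul_atTop k hc).def (c := 1 / (|B| + 1)) (by positivity)
  filter_upwards [tendsto_natCast_atTop_atTop.eventually h] with d hd
  rw [Real.norm_of_nonneg (by positivity), Real.norm_of_nonneg (by positivity),
    div_mul_eq_mul_div, one_mul, le_div_iff₀ (by positivity)] at hd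
  refine le_trans ?_ hd
  rw [mul_comm]
  gcongr
  linarith [le_abs_self B]

theorem exists_gaussianMeasure_manyComponents_le :
    ∃ C c : ℝ, 0 < C ∧ 0 < c ∧ ∀ d : ℕ, gaussianMeasure (degIndex d)
      {a | ∃ n : ℕ, (d : ℝ) ^ 2 / 4 ≤ n ∧ ∃ φ : Fin n →
        ConnectedComponents {q : ℝ × ℝ // kostlanPoly₂ d a q.1 q.2 = 0}, Function.Injective φ} ≤
      ENNReal.ofReal (C * Real.exp (-c * d)) := by
  obtain ⟨r, hr⟩ : ∃ r : ℝ, r = 1 / 10 ^ 14 := ⟨_, rfl⟩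
  have hr0 : 0 < r := by rw [hr]; positivity
  have hr1 : r ≤ 1 := by rw [hr]; norm_num
  obtain ⟨n, hn, Q, E, F, hF, hcov⟩ := exists_frame_cover (s := r / 32) (by positivity)
    (by linarith)
  set K := Fintype.card (Fin 3 → Fin (2 * n + 1)) with hK
  have hKr : (K : ℝ) * r ^ 4 * 6400 ≤ 1 / 100 := by
    have h1 : (K : ℝ) ≤ (15 / (r / 32)) ^ 3 := by
      rw [hK, Fintype.card_fun, Fintype.card_fin, Fintype.card_fin]
      push_cast at hn ⊢
      gcongr
    calc (K : ℝ) * r ^ 4 * 6400 ≤ (15 / (r / 32)) ^ 3 * r ^ 4 * 6400 := by gcongr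
      _ ≤ 1 / 100 := by rw [hr]; norm_num
  have hc : 0 < r ^ 2 := by positivity
  suffices h : ∀ᶠ d : ℕ in Filter.atTop, gaussianMeasure (degIndex d)
      {a | ∃ n : ℕ, (d : ℝ) ^ 2 / 4 ≤ n ∧ ∃ φ : Fin n →
        ConnectedComponents {q : ℝ × ℝ // kostlanPoly₂ d a q.1 q.2 = 0}, Function.Injective φ} ≤
      ENNReal.ofReal (2 * Real.exp (-r ^ 2 * d)) by
    obtain ⟨d₀, hd₀⟩ := Filter.eventually_atTop.1 h
    refine ⟨2 + Real.exp (r ^ 2 * d₀), r ^ 2, by positivity, hc, fun d => ?_⟩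
    rcases le_total d₀ d with hd | hd
    · refine (hd₀ d hd).trans (ENNReal.ofReal_le_ofReal ?_)
      gcongr
      linarith [Real.exp_pos (r ^ 2 * d₀)]
    · refine prob_le_one.trans ?_
      rw [← ENNReal.ofReal_one]
      refine ENNReal.ofReal_le_ofReal ?_
      rw [add_mul, ← Real.exp_add]
      have h1 : (1 : ℝ) ≤ Real.exp (r ^ 2 * d₀ + -r ^ 2 * d) := by
        refine Real.one_le_exp ?_
        have : (d : ℝ) ≤ d₀ := Nat.cast_le.2 hd
        nlinarith
      have h2 := Real.exp_pos (-r ^ 2 * d)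
      linarith
  have hlarge : ∀ᶠ d : ℕ in Filter.atTop, 100 * (K + 1 : ℝ) * (r ^ 2 + 1) ≤ (d : ℝ) :=
    tendsto_natCast_atTop_atTop.eventually_ge_atTop _
  filter_upwards [Filter.eventually_ge_atTop 2, hlarge,
    eventually_mul_pow_le_exp (512 * (64 * 9 / r ^ 3) ^ 4) 8 hc,
    eventually_mul_pow_le_exp (2 * K * (43200 * Real.exp 6 * (64 * 9 / r ^ 3) ^ 2 * 27)) 7 hc]
    with d hd2 hd3 hd4 hd5
  have hd : (2 : ℝ) ≤ d := by exact_mod_cast hd2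
  have hMle : 3 * (d : ℝ) * (d + 2) * Real.exp (d * r ^ 2) ≤
      9 * d ^ 2 * Real.exp (r ^ 2 * d) := by
    rw [mul_comm (d : ℝ) (r ^ 2)]
    exact mul_le_mul_of_nonneg_right (by nlinarith) (Real.exp_pos _).le
  set L := ⌈40 * (r ^ 2 * d)⌉₊ with hL
  have hL1 : 40 * (r ^ 2 * d) ≤ L := Nat.le_ceil _
  have hL2 : (L : ℝ) ≤ 40 * (r ^ 2 * d) + 1 := (Nat.ceil_lt_add_one (by positivity)).le
  have hLpow : 512 * (64 * (3 * (d : ℝ) * (d + 2) * Real.exp (d * r ^ 2)) / r ^ 3) ^ 4 /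
      Real.exp (-4 * (r ^ 2 * d)) ^ 4 ≤ 2 ^ L := by
    have h2 : (2 : ℝ) ^ L = Real.exp (L * Real.log 2) := by
      rw [mul_comm, Real.exp_mul, Real.exp_log two_pos, Real.rpow_natCast]
    rw [h2, div_le_iff₀ (by positivity)]
    calc 512 * (64 * (3 * (d : ℝ) * (d + 2) * Real.exp (d * r ^ 2)) / r ^ 3) ^ 4
        ≤ 512 * (64 * (9 * d ^ 2 * Real.exp (r ^ 2 * d)) / r ^ 3) ^ 4 := by gcongr
      _ = 512 * (64 * 9 / r ^ 3) ^ 4 * d ^ 8 * Real.exp (r ^ 2 * d) ^ 4 := by ring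
      _ ≤ Real.exp (r ^ 2 * d) * Real.exp (r ^ 2 * d) ^ 4 := by gcongr
      _ ≤ Real.exp (L * Real.log 2) * Real.exp (-4 * (r ^ 2 * d)) ^ 4 := by
        rw [← Real.exp_nat_mul, ← Real.exp_nat_mul, ← Real.exp_add, ← Real.exp_add]
        refine Real.exp_le_exp.2 ?_
        have h3 := Real.log_two_gt_d9
        have h4 : (0 : ℝ) ≤ r ^ 2 * d := by positivity
        push_cast
        nlinarith
  have hcount : ((4 * d + K * (4 * d + 2 * L * (2 * L)) : ℕ) : ℝ) < (d : ℝ) ^ 2 / 4 := by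
    push_cast
    have h1 : (L : ℝ) * L ≤ (40 * (r ^ 2 * d) + 1) * (40 * (r ^ 2 * d) + 1) := by gcongr
    have h2 := mul_le_mul_of_nonneg_left h1 (Nat.cast_nonneg (α := ℝ) K)
    have h3 := mul_le_mul_of_nonneg_right hKr (sq_nonneg (d : ℝ))
    have h4 := mul_le_mul_of_nonneg_right hd3 (by positivity : (0 : ℝ) ≤ d)
    have h5 : r ^ 2 ≤ 1 / 1000 := by rw [hr]; norm_num
    have h6 : (K : ℝ) * r ^ 2 * d ≤ K * (1 / 1000) * d := by gcongr
    have h7 : (0 : ℝ) ≤ K * d * r ^ 2 := by positivity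
    have h8 : (0 : ℝ) ≤ d * r ^ 2 := by positivity
    have h9 : (K : ℝ) * 2 ≤ K * d := by gcongr
    nlinarith
  refine (gaussianMeasure_manyComponents_le hd2 hF hcov (R := 3 * d) (by linarith) hr0 hr1 le_rfl
    (Real.exp_pos _) (Real.exp_le_one_iff.2 (by nlinarith)) rfl hLpow hcount).trans ?_
  rw [← ENNReal.ofReal_add (by positivity) (by positivity)]
  refine ENNReal.ofReal_le_ofReal ?_
  rw [two_mul (Real.exp _)]
  refine add_le_add ?_ ?_
  · have h1 : (Fintype.card (degIndex d) : ℝ) ≤ (d + 1) ^ 2 := by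
      exact_mod_cast card_degIndex_le d
    rw [show (2 : ℝ) = Real.exp (Real.log 2) by rw [Real.exp_log two_pos], ← Real.exp_mul,
      Real.exp_log two_pos, ← Real.exp_add]
    refine Real.exp_le_exp.2 ?_
    have h2 := Real.log_two_lt_d9
    have h3 := Real.log_two_gt_d9
    have h4 : Real.log 2 * ((Fintype.card (degIndex d) : ℝ) / 2) ≤ 1 * ((d + 1) ^ 2 / 2) := by
      gcongr
      linarith
    nlinarith
  · calc 2 * K * (43200 * Real.exp 6 *
          (64 * (3 * (d : ℝ) * (d + 2) * Real.exp (d * r ^ 2)) / r ^ 3) ^ 2 * (3 * d) ^ 3 *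
            Real.exp (-4 * (r ^ 2 * d)))
        ≤ 2 * K * (43200 * Real.exp 6 *
          (64 * (9 * d ^ 2 * Real.exp (r ^ 2 * d)) / r ^ 3) ^ 2 * (3 * d) ^ 3 *
            Real.exp (-4 * (r ^ 2 * d))) := by gcongr
      _ = 2 * K * (43200 * Real.exp 6 * (64 * 9 / r ^ 3) ^ 2 * 27) * d ^ 7 *
          (Real.exp (r ^ 2 * d) ^ 2 * Real.exp (-4 * (r ^ 2 * d))) := by ring
      _ ≤ Real.exp (r ^ 2 * d) *
          (Real.exp (r ^ 2 * d) ^ 2 * Real.exp (-4 * (r ^ 2 * d))) := by gcongr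
      _ = Real.exp (-r ^ 2 * d) := by
        rw [← Real.exp_nat_mul, ← Real.exp_add, ← Real.exp_add]
        congr 1
        push_cast
        ring

/-- Exponential rarefaction of curves with many real connected components: for every sequence
`a(d) ≥ 1` of rationals, there exist `C, D > 0` such that for every `d ≥ 1` the Gaussian
measure of the set of coefficient vectors whose Kostlan polynomial has a real zero set in `ℝ²`
with at least `d²/2 − d·a(d)` connected components is at most `C·d⁶·exp(−D·d/a(d))`. -/
theorem rarefaction_connected_components (A : ℕ → ℚ) (hA : ∀ d, 1 ≤ A d) :
    ∃ C D : ℝ, 0 < C ∧ 0 < D ∧ ∀ d : ℕ, 1 ≤ d →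
      gaussianMeasure (degIndex d)
        {a : degIndex d → ℝ |
          ∃ n : ℕ,
            (d : ℝ) ^ 2 / 2 - d * (A d : ℝ) ≤ (n : ℝ) ∧
            ∃ φ : Fin n →
              ConnectedComponents {q : ℝ × ℝ // kostlanPoly₂ d a q.1 q.2 = 0},
              Function.Injective φ}
      ≤ ENNReal.ofReal (C * (d : ℝ) ^ 6 * Real.exp (-D * d / (A d : ℝ))) := by
  obtain ⟨C, c, hC, hc, h⟩ := exists_gaussianMeasure_manyComponents_le
  refine ⟨C + Real.exp (c * 4), c, by positivity, hc, fun d hd => ?_⟩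
  have hd1 : (1 : ℝ) ≤ d := by exact_mod_cast hd
  have hd6 : (1 : ℝ) ≤ (d : ℝ) ^ 6 := one_le_pow₀ hd1
  have hA1 : (1 : ℝ) ≤ (A d : ℝ) := by exact_mod_cast hA d
  have hA0 : (0 : ℝ) < A d := by linarith
  have he := Real.exp_pos (-c * d / (A d : ℝ))
  have hfac : (C + Real.exp (c * 4)) * Real.exp (-c * d / (A d : ℝ)) ≤
      (C + Real.exp (c * 4)) * (d : ℝ) ^ 6 * Real.exp (-c * d / (A d : ℝ)) := by
    gcongr
    exact le_mul_of_one_le_right (by positivity) hd6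
  rcases le_total ((A d : ℝ) * 4) d with hAd | hAd
  · refine le_trans (measure_mono ?_) ((h d).trans (ENNReal.ofReal_le_ofReal (le_trans ?_ hfac)))
    · rintro a ⟨n, hn, hφ⟩
      exact ⟨n, by nlinarith, hφ⟩
    · gcongr
      · linarith [Real.exp_pos (c * 4)]
      · rw [le_div_iff₀ hA0]
        nlinarith [mul_le_mul_of_nonneg_left hA1 (by positivity : 0 ≤ c * d)]
  · refine prob_le_one.trans ?_
    rw [← ENNReal.ofReal_one]
    refine ENNReal.ofReal_le_ofReal (le_trans ?_ hfac)
    have h1 : 1 ≤ Real.exp (c * 4) * Real.exp (-c * d / (A d : ℝ)) := by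
      rw [← Real.exp_add]
      refine Real.one_le_exp ?_
      have : c * d / (A d : ℝ) ≤ c * 4 := by
        rw [div_le_iff₀ hA0, mul_assoc]
        gcongr
        linarith
      rw [neg_mul, neg_div]
      linarith
    nlinarith [mul_pos hC he]
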